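/- arXiv:1606.03840 — 10 statements merged into one kernel-verified Lean document; each statement's English description precedes it below -/
import Mathlib

section
/- Let ε = 1 or ε = −1, let A₁ ∈ ℂ^{n×n} be invertible, let A₀ ∈ ℂ^{n×n} satisfy A₀ᴴ = εA₀, and let (X, T) be a standard pair of Q(λ) = λ²A₁ᴴ + λA₀ + εA₁, i.e. T ∈ ℂ^{2n×2n} is invertible, the 2n×2n matrix W = [X; −XT⁻¹] is invertible, and A₁ᴴXT² + A₀XT + εA₁X = 0. Define L = [[0, Iₙ],[A₁ᴴ, 0]], J_ε = [[0, Iₙ],[−εIₙ, 0]] (2n×2n block matrices) and S = (WᴴLJ_εLᴴW)⁻¹. Then: (i) Sᴴ = −εS; (ii) TSTᴴ = S; (iii) XSXᴴ = 0; (iv) XT⁻¹SXᴴ = εA₁⁻¹ (in particular XT⁻¹SXᴴ is invertible and A₁ = ε(XT⁻¹SXᴴ)⁻¹); (v) A₀ = −A₁XT⁻²SXᴴA₁. -/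
open Matrix

/-- Spectral decomposition of a quadratic *-(anti)-palindromic system
`Q(λ) = λ²A₁ᴴ + λA₀ + εA₁`: given a standard pair `(X, T)`, the parameter
matrix `S = (WᴴLJεLᴴW)⁻¹` satisfies `Sᴴ = -εS`, `TSTᴴ = S`, `XSXᴴ = 0`,
`XT⁻¹SXᴴ = εA₁⁻¹` (invertible) and `A₀ = -A₁XT⁻²SXᴴA₁`. -/
theorem spectral_decomposition_star_palindromic {n : ℕ} (ε : ℂ)
    (hε : ε = 1 ∨ ε = -1)
    (A₁ A₀ : Matrix (Fin n) (Fin n) ℂ)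
    (hA₁ : IsUnit A₁.det) (hA₀ : A₀ᴴ = ε • A₀)
    (X : Matrix (Fin n) (Fin n ⊕ Fin n) ℂ)
    (T : Matrix (Fin n ⊕ Fin n) (Fin n ⊕ Fin n) ℂ) (hT : IsUnit T.det)
    (W : Matrix (Fin n ⊕ Fin n) (Fin n ⊕ Fin n) ℂ)
    (hW : W = Matrix.fromRows X (-(X * T⁻¹))) (hWu : IsUnit W.det)
    (heig : A₁ᴴ * X * T ^ 2 + A₀ * X * T + ε • (A₁ * X) = 0)
    (L Jε S : Matrix (Fin n ⊕ Fin n) (Fin n ⊕ Fin n) ℂ)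
    (hL : L = Matrix.fromBlocks 0 1 A₁ᴴ 0)
    (hJ : Jε = Matrix.fromBlocks 0 1 (-(ε • (1 : Matrix (Fin n) (Fin n) ℂ))) 0)
    (hS : S = (Wᴴ * L * Jε * Lᴴ * W)⁻¹) :
    Sᴴ = -(ε • S) ∧
    T * S * Tᴴ = S ∧
    X * S * Xᴴ = 0 ∧
    IsUnit (X * T⁻¹ * S * Xᴴ).det ∧
    X * T⁻¹ * S * Xᴴ = ε • A₁⁻¹ ∧
    A₁ = ε • (X * T⁻¹ * S * Xᴴ)⁻¹ ∧
    A₀ = -(A₁ * X * (T ^ 2)⁻¹ * S * Xᴴ * A₁) := by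
  have hε2 : ε * ε = 1 := by rcases hε with h | h <;> simp [h]
  have hεs : star ε = ε := by rcases hε with h | h <;> simp [h]
  have hB : IsUnit (A₁ᴴ).det := by rw [det_conjTranspose]; exact hA₁.star
  have hM : L * Jε * Lᴴ = fromBlocks 0 (-(ε • A₁)) A₁ᴴ 0 := by
    simp [hL, hJ, fromBlocks_multiply, fromBlocks_conjTranspose]
  set N : Matrix (Fin n ⊕ Fin n) (Fin n ⊕ Fin n) ℂ :=
    fromBlocks 0 (A₁ᴴ)⁻¹ (-(ε • A₁⁻¹)) 0 with hN
  have hMN : (L * Jε * Lᴴ)⁻¹ = N := by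
    refine inv_eq_right_inv ?_
    rw [hM, hN, fromBlocks_multiply]
    simp [mul_nonsing_inv _ hA₁, mul_nonsing_inv _ hB, smul_smul, hε2]
  have hS' : S = W⁻¹ * N * (W⁻¹)ᴴ := by
    rw [hS, ← hMN, conjTranspose_nonsing_inv]
    simp only [Matrix.mul_assoc, Matrix.mul_inv_rev]
  have hWH : IsUnit (Wᴴ).det := by rw [det_conjTranspose]; exact hWu.star
  have hWSW : W * S * Wᴴ = N := by
    rw [hS', conjTranspose_nonsing_inv]
    simp only [Matrix.mul_assoc, nonsing_inv_mul _ hWH, Matrix.mul_one]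
    exact mul_nonsing_inv_cancel_left _ _ hWu
  have hblocks : fromBlocks (X * S * Xᴴ) (-(X * S * (X * T⁻¹)ᴴ))
      (-(X * T⁻¹ * S * Xᴴ)) (X * T⁻¹ * S * (X * T⁻¹)ᴴ) = N := by
    rw [← hWSW, hW, fromRows_mul, conjTranspose_fromRows_eq_fromCols_conjTranspose,
      fromRows_mul_fromCols]
    simp
  obtain ⟨h11, -, h21, -⟩ := fromBlocks_inj.mp (hblocks.trans hN)
  rw [neg_inj] at h21
  have hTT : T * T⁻¹ = 1 := mul_nonsing_inv _ hT
  have hXT : A₁ᴴ * (X * T) + A₀ * X + ε • (A₁ * (X * T⁻¹)) = 0 := by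
    have h := congrArg (· * T⁻¹) heig
    simpa [Matrix.add_mul, pow_two, Matrix.mul_assoc, hTT] using h
  have hX : A₁ᴴ * X + A₀ * (X * T⁻¹) + ε • (A₁ * (X * (T ^ 2)⁻¹)) = 0 := by
    have h := congrArg (· * T⁻¹) hXT
    simpa [Matrix.add_mul, pow_two, Matrix.mul_assoc, hTT, Matrix.mul_inv_rev] using h
  set C : Matrix (Fin n ⊕ Fin n) (Fin n ⊕ Fin n) ℂ :=
    fromBlocks (-((A₁ᴴ)⁻¹ * A₀)) (ε • ((A₁ᴴ)⁻¹ * A₁)) (-1) 0 with hC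
  have hWT : W * T = C * W := by
    have h : X * T = -((A₁ᴴ)⁻¹ * (A₀ * X)) - ε • ((A₁ᴴ)⁻¹ * (A₁ * (X * T⁻¹))) := by
      have h := congrArg ((A₁ᴴ)⁻¹ * ·) hXT
      simp only [Matrix.mul_add, nonsing_inv_mul_cancel_left _ _ hB, Matrix.mul_smul,
        Matrix.mul_zero] at h
      rw [add_assoc] at h
      rw [eq_neg_of_add_eq_zero_left h]
      abel
    rw [hW, hC, fromRows_mul, fromBlocks_mul_fromRows, h]
    simp [Matrix.mul_assoc, nonsing_inv_mul _ hT, sub_eq_add_neg]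
  have hCN : C * N * Cᴴ = N := by
    rw [hC, hN, fromBlocks_conjTranspose, fromBlocks_multiply, fromBlocks_multiply]
    simp [conjTranspose_nonsing_inv, hA₀, hεs, smul_smul, hε2, Matrix.mul_assoc,
      mul_nonsing_inv _ hA₁, nonsing_inv_mul_cancel_left _ _ hB]
  have hdet : X * T⁻¹ * S * Xᴴ = ε • A₁⁻¹ := h21
  have hinv : (ε • A₁⁻¹) * (ε • A₁) = 1 := by
    simp [smul_smul, hε2, nonsing_inv_mul _ hA₁]
  refine ⟨?_, ?_, h11, ?_, hdet, ?_, ?_⟩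
  · have hNH : Nᴴ = -(ε • N) := by
      rw [hN, fromBlocks_conjTranspose, fromBlocks_smul, fromBlocks_neg]
      simp [conjTranspose_nonsing_inv, smul_smul, hε2, hεs]
    rw [hS']
    simp [conjTranspose_mul, hNH, Matrix.mul_assoc]
  · have h : W * (T * S * Tᴴ) * Wᴴ = W * S * Wᴴ := by
      calc W * (T * S * Tᴴ) * Wᴴ = (W * T) * S * (W * T)ᴴ := by
            simp only [conjTranspose_mul, Matrix.mul_assoc]
        _ = C * (W * S * Wᴴ) * Cᴴ := by
            rw [hWT]; simp only [conjTranspose_mul, Matrix.mul_assoc]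
        _ = W * S * Wᴴ := by rw [hWSW, hCN]
    have hu : IsUnit W := (isUnit_iff_isUnit_det _).mpr hWu
    have huH : IsUnit Wᴴ := (isUnit_iff_isUnit_det _).mpr hWH
    exact hu.mul_left_cancel (huH.mul_right_cancel h)
  · rw [hdet]
    exact isUnit_det_of_right_inverse hinv
  · rw [hdet, inv_eq_right_inv hinv, smul_smul, hε2, one_smul]
  · have h := congrArg (· * (S * Xᴴ * A₁)) hX
    have h11' : X * (S * (Xᴴ * A₁)) = 0 := by
      simp only [← Matrix.mul_assoc, h11, Matrix.zero_mul]
    have h21' : X * (T⁻¹ * (S * (Xᴴ * A₁))) = ε • 1 := by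
      simp only [← Matrix.mul_assoc, hdet, Matrix.smul_mul, nonsing_inv_mul _ hA₁]
    simp only [Matrix.add_mul, Matrix.smul_mul, Matrix.mul_assoc, h11', h21', Matrix.mul_zero,
      Matrix.mul_smul, Matrix.mul_one, Matrix.zero_mul, zero_add, ← smul_add] at h
    have h' := congrArg (ε • ·) h
    simp only [smul_smul, hε2, one_smul, smul_zero] at h'
    simpa only [Matrix.mul_assoc] using eq_neg_of_add_eq_zero_left h'
end

section
/- Let ε = 1 or ε = −1, let A₁ ∈ ℂ^{n×n} be invertible, let A₀ ∈ ℂ^{n×n} satisfy A₀ᵀ = εA₀, and let (X, T) be a standard pair of Q(λ) = λ²A₁ᵀ + λA₀ + εA₁, i.e. T ∈ ℂ^{2n×2n} is invertible, the 2n×2n matrix W = [X; −XT⁻¹] is invertible, and A₁ᵀXT² + A₀XT + εA₁X = 0. Define L = [[0, Iₙ],[A₁ᵀ, 0]], J_ε = [[0, Iₙ],[−εIₙ, 0]] (2n×2n block matrices) and S = (WᵀLJ_εLᵀW)⁻¹. Then: (i) Sᵀ = −εS; (ii) TSTᵀ = S; (iii) XSXᵀ = 0; (iv) XT⁻¹SXᵀ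 = εA₁⁻¹ (in particular XT⁻¹SXᵀ is invertible and A₁ = ε(XT⁻¹SXᵀ)⁻¹); (v) A₀ = −A₁XT⁻²SXᵀA₁. -/
open Matrix

/-- Spectral decomposition of a quadratic *-(anti)-palindromic system
`Q(λ) = λ²A₁ᵀ + λA₀ + εA₁`: given a standard pair `(X, T)`, the parameter
matrix `S = (WᵀLJεLᵀW)⁻¹` satisfies `Sᵀ = -εS`, `TSTᵀ = S`, `XSXᵀ = 0`,
`XT⁻¹SXᵀ = εA₁⁻¹` (invertible) and `A₀ = -A₁XT⁻²SXᵀA₁`. -/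
theorem spectral_decomposition_top_palindromic {n : ℕ} (ε : ℂ)
    (hε : ε = 1 ∨ ε = -1)
    (A₁ A₀ : Matrix (Fin n) (Fin n) ℂ)
    (hA₁ : IsUnit A₁.det) (hA₀ : A₀ᵀ = ε • A₀)
    (X : Matrix (Fin n) (Fin n ⊕ Fin n) ℂ)
    (T : Matrix (Fin n ⊕ Fin n) (Fin n ⊕ Fin n) ℂ) (hT : IsUnit T.det)
    (W : Matrix (Fin n ⊕ Fin n) (Fin n ⊕ Fin n) ℂ)
    (hW : W = Matrix.fromRows X (-(X * T⁻¹))) (hWu : IsUnit W.det)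
    (heig : A₁ᵀ * X * T ^ 2 + A₀ * X * T + ε • (A₁ * X) = 0)
    (L Jε S : Matrix (Fin n ⊕ Fin n) (Fin n ⊕ Fin n) ℂ)
    (hL : L = Matrix.fromBlocks 0 1 A₁ᵀ 0)
    (hJ : Jε = Matrix.fromBlocks 0 1 (-(ε • (1 : Matrix (Fin n) (Fin n) ℂ))) 0)
    (hS : S = (Wᵀ * L * Jε * Lᵀ * W)⁻¹) :
    Sᵀ = -(ε • S) ∧
    T * S * Tᵀ = S ∧
    X * S * Xᵀ = 0 ∧
    IsUnit (X * T⁻¹ * S * Xᵀ).det ∧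
    X * T⁻¹ * S * Xᵀ = ε • A₁⁻¹ ∧
    A₁ = ε • (X * T⁻¹ * S * Xᵀ)⁻¹ ∧
    A₀ = -(A₁ * X * (T ^ 2)⁻¹ * S * Xᵀ * A₁) := by
  have hεε : ε * ε = 1 := by rcases hε with rfl | rfl <;> norm_num
  have hε0 : ε ≠ 0 := left_ne_zero_of_mul_eq_one hεε
  have hTT' : T * T⁻¹ = 1 := mul_nonsing_inv _ hT
  have hT'T : T⁻¹ * T = 1 := nonsing_inv_mul _ hT
  set K : Matrix (Fin n ⊕ Fin n) (Fin n ⊕ Fin n) ℂ := fromBlocks 0 (-(ε • A₁)) A₁ᵀ 0 with hK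
  set N : Matrix (Fin n ⊕ Fin n) (Fin n ⊕ Fin n) ℂ := fromBlocks 0 (A₁⁻¹)ᵀ (-(ε • A₁⁻¹)) 0 with hN
  have hLJL : L * Jε * Lᵀ = K := by
    simp [hL, hJ, hK, fromBlocks_multiply, fromBlocks_transpose]
  have hKN : K * N = 1 := by
    simp [hK, hN, fromBlocks_multiply, smul_smul, hεε, mul_nonsing_inv _ hA₁, ← transpose_mul,
      nonsing_inv_mul _ hA₁]
  have hKt : Kᵀ = -(ε • K) := by
    simp [hK, fromBlocks_transpose, fromBlocks_smul, fromBlocks_neg, smul_smul, hεε]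
  set M := Wᵀ * K * W with hM
  have hSM : S = M⁻¹ := by rw [hS, hM, ← hLJL]; simp only [Matrix.mul_assoc]
  have hMu : IsUnit M.det := by
    rw [hM, det_mul, det_mul, det_transpose]
    exact (hWu.mul (isUnit_det_of_right_inverse hKN)).mul hWu
  have hMS : M * S = 1 := by rw [hSM, mul_nonsing_inv _ hMu]
  have hMt : Mᵀ = -(ε • M) := by
    simp [hM, transpose_mul, hKt, Matrix.mul_assoc]
  have hXT : A₁ᵀ * X * T = -(A₀ * X) - ε • (A₁ * (X * T⁻¹)) := by
    have h := congrArg (· * T⁻¹) heig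
    simp only [Matrix.add_mul, Matrix.zero_mul, pow_two, Matrix.mul_assoc, hTT', Matrix.mul_one,
      Matrix.smul_mul] at h
    rw [Matrix.mul_assoc, eq_sub_iff_add_eq, eq_neg_iff_add_eq_zero, ← h]
    abel
  have hMX : M = ε • (Xᵀ * A₁ * (X * T⁻¹)) - (X * T⁻¹)ᵀ * (A₁ᵀ * X) := by
    rw [hM, hW, hK, transpose_fromRows, Matrix.mul_assoc, fromBlocks_mul_fromRows,
      fromCols_mul_fromRows]
    simp [Matrix.mul_assoc, sub_eq_add_neg]
  have hTMT : Tᵀ * M * T = M := by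
    have hXTt : Tᵀ * Xᵀ * A₁ = -(ε • (Xᵀ * A₀)) - ε • ((X * T⁻¹)ᵀ * A₁ᵀ) := by
      have h := congrArg transpose hXT
      simpa [transpose_mul, hA₀, Matrix.mul_assoc] using h
    have hYT : X * T⁻¹ * T = X := by rw [Matrix.mul_assoc, hT'T, Matrix.mul_one]
    have hYTt : Tᵀ * (X * T⁻¹)ᵀ = Xᵀ := by rw [← transpose_mul, hYT]
    calc Tᵀ * M * T
        = ε • ((Tᵀ * Xᵀ * A₁) * (X * T⁻¹ * T)) - (Tᵀ * (X * T⁻¹)ᵀ) * (A₁ᵀ * X * T) := by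
          rw [hMX]
          simp only [Matrix.mul_sub, Matrix.sub_mul, Matrix.mul_smul, Matrix.smul_mul,
            Matrix.mul_assoc]
      _ = M := by
          rw [hXTt, hYT, hYTt, hXT, hMX]
          simp only [Matrix.mul_sub, Matrix.sub_mul, Matrix.mul_smul, Matrix.smul_mul,
            Matrix.mul_neg, Matrix.neg_mul, smul_sub, smul_neg, smul_smul, hεε, one_smul,
            Matrix.mul_assoc]
          abel
  have hWSW : W * S * Wᵀ = N := by
    have h : (Wᵀ * K) * (W * S) = 1 := by rw [← Matrix.mul_assoc, ← hM, hMS]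
    have h' : K * (W * S * Wᵀ) = 1 := by
      have h₁ := mul_eq_one_comm.mp h
      have h₂ : (W * S * Wᵀ) * K = 1 := by rw [Matrix.mul_assoc, h₁]
      exact mul_eq_one_comm.mp h₂
    rw [← inv_eq_right_inv h', inv_eq_right_inv hKN]
  have hblocks : fromBlocks (X * S * Xᵀ) (-(X * S * (X * T⁻¹)ᵀ)) (-(X * T⁻¹ * S * Xᵀ))
      (X * T⁻¹ * S * (X * T⁻¹)ᵀ) = N := by
    rw [← hWSW, hW, transpose_fromRows, fromRows_mul, fromRows_mul_fromCols]
    simp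
  rw [hN, fromBlocks_inj] at hblocks
  obtain ⟨hXSX, -, hYSX, -⟩ := hblocks
  rw [neg_inj] at hYSX
  have hYSX_mul : X * T⁻¹ * S * Xᵀ * (ε • A₁) = 1 := by
    rw [hYSX]
    simp [smul_smul, hεε, nonsing_inv_mul _ hA₁]
  refine ⟨?_, ?_, hXSX, ?_, hYSX, ?_, ?_⟩
  · have h : Mᵀ * -(ε • S) = 1 := by
      simp [hMt, smul_smul, hεε, hMS]
    rw [← inv_eq_right_inv h, hSM, transpose_nonsing_inv]
  · have h : M * (T * S * Tᵀ) = 1 := by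
      have h₁ : Tᵀ * (M * (T * S)) = 1 := by
        rw [← Matrix.mul_assoc, ← Matrix.mul_assoc, hTMT, hMS]
      rw [← Matrix.mul_assoc]
      exact mul_eq_one_comm.mp h₁
    exact (inv_eq_right_inv h).symm.trans hSM.symm
  · exact isUnit_det_of_right_inverse hYSX_mul
  · rw [inv_eq_right_inv hYSX_mul, smul_smul, hεε, one_smul]
  · have hT2 : T ^ 2 * (T ^ 2)⁻¹ = 1 :=
      mul_nonsing_inv _ (by rw [det_pow]; exact hT.pow 2)
    have hTT2 : T * (T ^ 2)⁻¹ = T⁻¹ := by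
      rw [pow_two, Matrix.mul_inv_rev, ← Matrix.mul_assoc, hTT', Matrix.one_mul]
    have h := congrArg (· * ((T ^ 2)⁻¹ * S * Xᵀ * A₁)) heig
    have e₁ : A₁ᵀ * X * T ^ 2 * ((T ^ 2)⁻¹ * S * Xᵀ * A₁) = 0 := by
      calc _ = A₁ᵀ * (X * (T ^ 2 * (T ^ 2)⁻¹) * S * Xᵀ) * A₁ := by simp only [Matrix.mul_assoc]
        _ = 0 := by rw [hT2, Matrix.mul_one, hXSX, Matrix.mul_zero, Matrix.zero_mul]
    have e₂ : A₀ * X * T * ((T ^ 2)⁻¹ * S * Xᵀ * A₁) = ε • A₀ := by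
      calc _ = A₀ * (X * (T * (T ^ 2)⁻¹) * S * Xᵀ) * A₁ := by simp only [Matrix.mul_assoc]
        _ = ε • A₀ := by
          rw [hTT2, hYSX, Matrix.mul_assoc, Matrix.smul_mul, nonsing_inv_mul _ hA₁,
            Matrix.mul_smul, Matrix.mul_one]
    have e₃ : ε • (A₁ * X) * ((T ^ 2)⁻¹ * S * Xᵀ * A₁)
        = ε • (A₁ * X * (T ^ 2)⁻¹ * S * Xᵀ * A₁) := by
      simp only [Matrix.smul_mul, Matrix.mul_assoc]
    simp only [Matrix.add_mul, e₁, e₂, e₃, zero_add, Matrix.zero_mul] at h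
    rw [← smul_add] at h
    exact eq_neg_of_add_eq_zero_left ((smul_eq_zero.mp h).resolve_left hε0)
end

section
/- Let ε = 1 or ε = −1, let X ∈ ℂ^{n×2n} and let T ∈ ℂ^{2n×2n} be invertible such that W = [X; −XT⁻¹] is invertible. Then there exist an invertible A₁ ∈ ℂ^{n×n} and A₀ ∈ ℂ^{n×n} with A₀ᴴ = εA₀ satisfying A₁ᴴXT² + A₀XT + εA₁X = 0 if and only if there exists an invertible S ∈ ℂ^{2n×2n} with Sᴴ = −εS, TSTᴴ = S, and XSXᴴ = 0. Moreover, for any such invertible S, the matrix XT⁻¹SXᴴ is invertible, and A₁ := ε(XT⁻¹SXᴴ)⁻¹, A₀ := −A₁XT⁻²SXᴴA₁ give such a solution (A₀ᴴ = εA₀ and A₁ᴴXT² + A₀XT + εA₁X = 0). -/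
open Matrix

namespace StarPalindromic

variable {n : Type*} [Fintype n] [DecidableEq n] {ε : ℂ}
  {X : Matrix n (n ⊕ n) ℂ} {T S : Matrix (n ⊕ n) (n ⊕ n) ℂ} {A₁ A₀ : Matrix n n ℂ}

theorem conjTranspose_fromRows_neg (X : Matrix n (n ⊕ n) ℂ) (T : Matrix (n ⊕ n) (n ⊕ n) ℂ) :
    (fromRows X (-(X * T⁻¹)))ᴴ = fromCols Xᴴ (-(T⁻¹ᴴ * Xᴴ)) := by
  rw [conjTranspose_fromRows_eq_fromCols_conjTranspose, conjTranspose_neg, conjTranspose_mul]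

theorem isUnit_det_of_isUnit_det_fromBlocks_zero {P Q : Matrix n n ℂ}
    (h : IsUnit (fromBlocks 0 P Q 0).det) : IsUnit Q.det := by
  have h1 := mul_nonsing_inv _ h
  rw [← fromBlocks_toBlocks (fromBlocks 0 P Q 0)⁻¹, fromBlocks_multiply, ← fromBlocks_one] at h1
  have h2 := (fromBlocks_inj.1 h1).2.2.2
  rw [zero_mul, add_zero] at h2
  exact isUnit_det_of_right_inverse h2

theorem inv_mul_mul_conjTranspose_inv (hT : IsUnit T.det) (hS : T * S * Tᴴ = S) :
    T⁻¹ * S * T⁻¹ᴴ = S := by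
  have h1 : Tᴴ * T⁻¹ᴴ = 1 := by
    rw [← conjTranspose_mul, nonsing_inv_mul _ hT, conjTranspose_one]
  calc T⁻¹ * S * T⁻¹ᴴ = T⁻¹ * (T * S * Tᴴ) * T⁻¹ᴴ := by rw [hS]
    _ = (T⁻¹ * T) * S * (Tᴴ * T⁻¹ᴴ) := by simp only [Matrix.mul_assoc]
    _ = S := by rw [h1, nonsing_inv_mul _ hT, Matrix.one_mul, Matrix.mul_one]

theorem mul_eq_mul_conjTranspose_inv (hT : IsUnit T.det) (hS : T * S * Tᴴ = S) :
    T * S = S * T⁻¹ᴴ := by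
  calc T * S = T * (T⁻¹ * S * T⁻¹ᴴ) := by rw [inv_mul_mul_conjTranspose_inv hT hS]
    _ = (T * T⁻¹) * S * T⁻¹ᴴ := by simp only [Matrix.mul_assoc]
    _ = S * T⁻¹ᴴ := by rw [mul_nonsing_inv _ hT, Matrix.one_mul]

theorem isUnit_det_mul_inv_mul_mul_conjTranspose (hT : IsUnit T.det)
    (hW : IsUnit (fromRows X (-(X * T⁻¹))).det) (hSu : IsUnit S.det)
    (hS : T * S * Tᴴ = S) (hX : X * S * Xᴴ = 0) : IsUnit (X * T⁻¹ * S * Xᴴ).det := by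
  have hY : X * T⁻¹ * S * (T⁻¹ᴴ * Xᴴ) = 0 := by
    calc X * T⁻¹ * S * (T⁻¹ᴴ * Xᴴ) = X * (T⁻¹ * S * T⁻¹ᴴ) * Xᴴ := by
          simp only [Matrix.mul_assoc]
      _ = 0 := by rw [inv_mul_mul_conjTranspose_inv hT hS, hX]
  have hK : fromRows X (-(X * T⁻¹)) * S * (fromRows X (-(X * T⁻¹)))ᴴ =
      fromBlocks 0 (-(X * S * (T⁻¹ᴴ * Xᴴ))) (-(X * T⁻¹ * S * Xᴴ)) 0 := by
    rw [conjTranspose_fromRows_neg, fromRows_mul, fromRows_mul_fromCols]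
    simp only [Matrix.neg_mul, Matrix.mul_neg, hX, hY, neg_zero]
  have hu : IsUnit (fromRows X (-(X * T⁻¹)) * S * (fromRows X (-(X * T⁻¹)))ᴴ).det := by
    rw [det_mul, det_mul, det_conjTranspose]
    exact (hW.mul hSu).mul hW.star
  rw [hK] at hu
  have h := isUnit_det_of_isUnit_det_fromBlocks_zero hu
  rw [← isUnit_iff_isUnit_det] at h ⊢
  exact IsUnit.neg_iff _ |>.1 h

theorem eq_zero_of_mul_conjTranspose_eq_zero {G : Matrix n (n ⊕ n) ℂ}
    (hW : IsUnit (fromRows X (-(X * T⁻¹))).det) (hSu : IsUnit S.det)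
    (h₁ : G * S * Xᴴ = 0) (h₂ : G * (S * T⁻¹ᴴ) * Xᴴ = 0) : G = 0 := by
  have hu : IsUnit (S * (fromRows X (-(X * T⁻¹)))ᴴ).det := by
    rw [det_mul, det_conjTranspose]
    exact hSu.mul hW.star
  have h : G * (S * (fromRows X (-(X * T⁻¹)))ᴴ) = 0 := by
    rw [conjTranspose_fromRows_neg, mul_fromCols, mul_fromCols]
    simp only [Matrix.mul_assoc] at h₁ h₂
    rw [Matrix.mul_neg, Matrix.mul_neg, h₁, h₂, neg_zero, fromCols_zero]
  rw [← mul_nonsing_inv_cancel_right _ G hu, h, Matrix.zero_mul]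

theorem isSolution_of_isUnit (hε : ε * ε = 1) (hεs : star ε = ε) (hT : IsUnit T.det)
    (hW : IsUnit (fromRows X (-(X * T⁻¹))).det) (hSu : IsUnit S.det) (hSs : Sᴴ = -(ε • S))
    (hS : T * S * Tᴴ = S) (hX : X * S * Xᴴ = 0)
    (hA₁ : A₁ = ε • (X * T⁻¹ * S * Xᴴ)⁻¹)
    (hA₀ : A₀ = -(A₁ * X * (T ^ 2)⁻¹ * S * Xᴴ * A₁)) :
    IsUnit A₁.det ∧ A₀ᴴ = ε • A₀ ∧ A₁ᴴ * X * T ^ 2 + A₀ * X * T + ε • (A₁ * X) = 0 := by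
  have hM := isUnit_det_mul_inv_mul_mul_conjTranspose hT hW hSu hS hX
  have hTi : (T ^ 2)⁻¹ = T⁻¹ * T⁻¹ := by rw [pow_two, Matrix.mul_inv_rev]
  have hTS := mul_eq_mul_conjTranspose_inv hT hS
  have hTSX : X * (T * S) * Xᴴ = -(ε • (X * T⁻¹ * S * Xᴴ)ᴴ) := by
    simp only [conjTranspose_mul, conjTranspose_conjTranspose, hSs, hTS, Matrix.mul_assoc,
      Matrix.neg_mul, Matrix.mul_neg, Matrix.smul_mul, Matrix.mul_smul, smul_neg, smul_smul, hε,
      one_smul, neg_neg]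
  have hTTSX : X * (T * (T * S)) * Xᴴ = -(ε • (X * (T ^ 2)⁻¹ * S * Xᴴ)ᴴ) := by
    rw [hTS, ← Matrix.mul_assoc T, hTS]
    simp only [hTi, conjTranspose_mul, conjTranspose_conjTranspose, hSs, Matrix.mul_assoc,
      Matrix.neg_mul, Matrix.mul_neg, Matrix.smul_mul, Matrix.mul_smul, smul_neg, smul_smul, hε,
      one_smul, neg_neg]
  set M := X * T⁻¹ * S * Xᴴ with hMdef
  set N := X * (T ^ 2)⁻¹ * S * Xᴴ with hNdef
  have hAM : A₁ * M = ε • 1 := by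
    rw [hA₁, Matrix.smul_mul, nonsing_inv_mul _ hM]
  have hMA : M * A₁ = ε • 1 := by
    rw [hA₁, Matrix.mul_smul, mul_nonsing_inv _ hM]
  have hMA' : A₁ᴴ * Mᴴ = ε • 1 := by
    rw [← conjTranspose_mul, hMA, conjTranspose_smul, hεs, conjTranspose_one]
  have hAM' : Mᴴ * A₁ᴴ = ε • 1 := by
    rw [← conjTranspose_mul, hAM, conjTranspose_smul, hεs, conjTranspose_one]
  have hA₀N : A₀ = -(A₁ * N * A₁) := by
    rw [hA₀, hNdef]; simp only [Matrix.mul_assoc]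
  have hG : A₁ᴴ * X + A₀ * X * T⁻¹ + ε • (A₁ * X * (T ^ 2)⁻¹) = 0 := by
    apply eq_zero_of_mul_conjTranspose_eq_zero hW hSu
    · have : (A₁ᴴ * X + A₀ * X * T⁻¹ + ε • (A₁ * X * (T ^ 2)⁻¹)) * S * Xᴴ =
          A₁ᴴ * (X * S * Xᴴ) + A₀ * M + ε • (A₁ * N) := by
        simp only [hMdef, hNdef, Matrix.add_mul, Matrix.smul_mul, Matrix.mul_assoc]
      rw [this, hX, hA₀N, Matrix.neg_mul, Matrix.mul_assoc _ A₁, hAM]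
      simp
    · have : (A₁ᴴ * X + A₀ * X * T⁻¹ + ε • (A₁ * X * (T ^ 2)⁻¹)) * (S * T⁻¹ᴴ) * Xᴴ =
          A₁ᴴ * (X * (S * T⁻¹ᴴ) * Xᴴ) + A₀ * (X * (T⁻¹ * S * T⁻¹ᴴ) * Xᴴ) +
            ε • (A₁ * (X * T⁻¹ * (T⁻¹ * S * T⁻¹ᴴ) * Xᴴ)) := by
        simp only [hTi, Matrix.add_mul, Matrix.smul_mul, Matrix.mul_assoc]
      rw [this, ← hTS, hTSX, inv_mul_mul_conjTranspose_inv hT hS, hX, ← hMdef, hAM,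
        Matrix.mul_neg, Matrix.mul_smul, hMA']
      simp
  have hE : A₁ᴴ * X * T ^ 2 + A₀ * X * T + ε • (A₁ * X) = 0 := by
    have h1 : T⁻¹ * T ^ 2 = T := by
      rw [pow_two, ← Matrix.mul_assoc, nonsing_inv_mul _ hT, Matrix.one_mul]
    have h2 : (T ^ 2)⁻¹ * T ^ 2 = 1 := nonsing_inv_mul _ (by rw [det_pow]; exact hT.pow 2)
    have h := congrArg (· * T ^ 2) hG
    simpa only [Matrix.add_mul, Matrix.smul_mul, Matrix.mul_assoc, h1, h2, Matrix.mul_one,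
      Matrix.zero_mul] using h
  refine ⟨?_, ?_, hE⟩
  · refine isUnit_det_of_right_inverse (B := ε • M) ?_
    rw [Matrix.mul_smul, hAM, smul_smul, hε, one_smul]
  · have h : A₁ᴴ * (X * (T * (T * S)) * Xᴴ) + A₀ * (X * (T * S) * Xᴴ) +
        ε • (A₁ * (X * S * Xᴴ)) = 0 := by
      have h' := congrArg (· * S * Xᴴ) hE
      simpa only [pow_two, Matrix.add_mul, Matrix.smul_mul, Matrix.mul_assoc,
        Matrix.zero_mul] using h'
    rw [hTTSX, hTSX, hX, Matrix.mul_zero, smul_zero, add_zero, Matrix.mul_neg, Matrix.mul_neg,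
      Matrix.mul_smul, Matrix.mul_smul] at h
    have h3 := congrArg (· * A₁ᴴ) h
    simp only [Matrix.add_mul, Matrix.neg_mul, Matrix.smul_mul, Matrix.zero_mul,
      Matrix.mul_assoc, hAM', Matrix.mul_smul, Matrix.mul_one, smul_smul, hε, one_smul] at h3
    rw [hA₀N, conjTranspose_neg, conjTranspose_mul, conjTranspose_mul, ← hA₀N]
    have h4 := congrArg (ε • ·) h3
    simp only [smul_add, smul_neg, smul_smul, hε, one_smul, smul_zero] at h4
    exact (neg_add_eq_zero.1 (by rw [← h4]; abel)).symm

theorem exists_of_isSolution (hε : ε * ε = 1) (hεs : star ε = ε) (hT : IsUnit T.det)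
    (hW : IsUnit (fromRows X (-(X * T⁻¹))).det) (hA₁ : IsUnit A₁.det) (hA₀ : A₀ᴴ = ε • A₀)
    (hE : A₁ᴴ * X * T ^ 2 + A₀ * X * T + ε • (A₁ * X) = 0) :
    ∃ S : Matrix (n ⊕ n) (n ⊕ n) ℂ, IsUnit S.det ∧ Sᴴ = -(ε • S) ∧ T * S * Tᴴ = S ∧
      X * S * Xᴴ = 0 := by
  set B := A₁⁻¹ with hB
  set W := fromRows X (-(X * T⁻¹)) with hWdef
  have hAB : A₁ * B = 1 := mul_nonsing_inv _ hA₁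
  have hBA : B * A₁ = 1 := nonsing_inv_mul _ hA₁
  have hAB' : Bᴴ * A₁ᴴ = 1 := by rw [← conjTranspose_mul, hAB, conjTranspose_one]
  have hBA' : A₁ᴴ * Bᴴ = 1 := by rw [← conjTranspose_mul, hBA, conjTranspose_one]
  have hG : A₁ᴴ * X + A₀ * X * T⁻¹ + ε • (A₁ * X * (T⁻¹ * T⁻¹)) = 0 := by
    have h1 : T ^ 2 * (T⁻¹ * T⁻¹) = 1 := by
      rw [pow_two, Matrix.mul_assoc, ← Matrix.mul_assoc T T⁻¹, mul_nonsing_inv _ hT,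
        Matrix.one_mul, mul_nonsing_inv _ hT]
    have h2 : T * (T⁻¹ * T⁻¹) = T⁻¹ := by
      rw [← Matrix.mul_assoc, mul_nonsing_inv _ hT, Matrix.one_mul]
    have h := congrArg (· * (T⁻¹ * T⁻¹)) hE
    simpa only [Matrix.add_mul, Matrix.smul_mul, Matrix.mul_assoc, h1, h2, Matrix.mul_one,
      Matrix.zero_mul] using h
  set C : Matrix (n ⊕ n) (n ⊕ n) ℂ :=
    fromBlocks 0 (-1) (ε • (B * A₁ᴴ)) (-(ε • (B * A₀))) with hC
  set K : Matrix (n ⊕ n) (n ⊕ n) ℂ := fromBlocks 0 Bᴴ (-(ε • B)) 0 with hK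
  have hWT : W * T⁻¹ = C * W := by
    have h := congrArg (fun Z => ε • (B * Z)) hG
    simp only [Matrix.mul_add, Matrix.mul_smul, smul_add, smul_smul, hε, one_smul,
      Matrix.mul_zero, smul_zero, ← Matrix.mul_assoc, hBA, Matrix.one_mul] at h
    rw [hWdef, hC, fromRows_mul, fromBlocks_mul_fromRows]
    congr 1
    · simp
    · simp only [Matrix.neg_mul, Matrix.mul_neg, Matrix.smul_mul, neg_neg, ← Matrix.mul_assoc]
      rw [neg_eq_iff_add_eq_zero, ← h]
      abel
  have hKs : Kᴴ = -(ε • K) := by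
    rw [hK, fromBlocks_conjTranspose, fromBlocks_smul, fromBlocks_neg]
    simp [conjTranspose_smul, hεs, smul_smul, hε]
  have hKu : IsUnit K.det := by
    refine isUnit_det_of_right_inverse (B := fromBlocks 0 (-(ε • A₁)) A₁ᴴ 0) ?_
    rw [hK, fromBlocks_multiply, ← fromBlocks_one]
    simp [hBA, hAB', smul_smul, hε]
  have hCK : C * K * Cᴴ = K := by
    have e1 : ∀ Z : Matrix n n ℂ, B * (A₁ * Z) = Z := fun Z => by
      rw [← Matrix.mul_assoc, hBA, Matrix.one_mul]
    rw [hC, hK, fromBlocks_conjTranspose, fromBlocks_multiply, fromBlocks_multiply]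
    simp [conjTranspose_smul, conjTranspose_mul, hεs, smul_smul, hε, hA₀, Matrix.mul_assoc,
      hBA', e1]
  have hWi : W * W⁻¹ = 1 := mul_nonsing_inv _ hW
  have hWi' : W⁻¹ᴴ * Wᴴ = 1 := by rw [← conjTranspose_mul, hWi, conjTranspose_one]
  have hWSW : W * (W⁻¹ * K * W⁻¹ᴴ) * Wᴴ = K := by
    calc _ = (W * W⁻¹) * K * (W⁻¹ᴴ * Wᴴ) := by simp only [Matrix.mul_assoc]
      _ = K := by rw [hWi, hWi', Matrix.one_mul, Matrix.mul_one]
  have hTW : T⁻¹ * W⁻¹ = W⁻¹ * C := by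
    calc T⁻¹ * W⁻¹ = W⁻¹ * (W * T⁻¹) * W⁻¹ := by
          rw [nonsing_inv_mul_cancel_left _ _ hW]
      _ = W⁻¹ * C := by
          rw [hWT, ← Matrix.mul_assoc, mul_nonsing_inv_cancel_right _ _ hW]
  refine ⟨W⁻¹ * K * W⁻¹ᴴ, ?_, ?_, ?_, ?_⟩
  · rw [det_mul, det_mul, det_conjTranspose]
    have := isUnit_nonsing_inv_det _ hW
    exact (this.mul hKu).mul this.star
  · rw [conjTranspose_mul, conjTranspose_mul, conjTranspose_conjTranspose, hKs]
    simp [Matrix.mul_assoc]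
  · have hS : T⁻¹ * (W⁻¹ * K * W⁻¹ᴴ) * T⁻¹ᴴ = W⁻¹ * K * W⁻¹ᴴ := by
      calc _ = (T⁻¹ * W⁻¹) * K * (T⁻¹ * W⁻¹)ᴴ := by
            simp only [conjTranspose_mul, Matrix.mul_assoc]
        _ = W⁻¹ * (C * K * Cᴴ) * W⁻¹ᴴ := by
            rw [hTW]; simp only [conjTranspose_mul, Matrix.mul_assoc]
        _ = _ := by rw [hCK]
    have h1 : T⁻¹ᴴ * Tᴴ = 1 := by
      rw [← conjTranspose_mul, mul_nonsing_inv _ hT, conjTranspose_one]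
    calc T * (W⁻¹ * K * W⁻¹ᴴ) * Tᴴ = T * (T⁻¹ * (W⁻¹ * K * W⁻¹ᴴ) * T⁻¹ᴴ) * Tᴴ := by rw [hS]
      _ = (T * T⁻¹) * (W⁻¹ * K * W⁻¹ᴴ) * (T⁻¹ᴴ * Tᴴ) := by simp only [Matrix.mul_assoc]
      _ = _ := by rw [h1, mul_nonsing_inv _ hT, Matrix.one_mul, Matrix.mul_one]
  · generalize W⁻¹ * K * W⁻¹ᴴ = S at hWSW
    rw [hWdef, conjTranspose_fromRows_neg, fromRows_mul, fromRows_mul_fromCols, hK] at hWSW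
    exact (fromBlocks_inj.1 hWSW).1

end StarPalindromic

/-- Solvability of the inverse eigenvalue problem IEP-QP(2n) for
*-(anti)-palindromic systems: a regular solution exists iff there is an
invertible `S` with `Sᴴ = -εS`, `TSTᴴ = S`, `XSXᴴ = 0`; and any such `S`
yields a solution via `A₁ = ε(XT⁻¹SXᴴ)⁻¹`, `A₀ = -A₁XT⁻²SXᴴA₁`. -/
theorem iep_qp_2n_star_palindromic {n : ℕ} (ε : ℂ) (hε : ε = 1 ∨ ε = -1)
    (X : Matrix (Fin n) (Fin n ⊕ Fin n) ℂ)
    (T : Matrix (Fin n ⊕ Fin n) (Fin n ⊕ Fin n) ℂ) (hT : IsUnit T.det)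
    (hW : IsUnit (Matrix.fromRows X (-(X * T⁻¹))).det) :
    ((∃ A₁ A₀ : Matrix (Fin n) (Fin n) ℂ, IsUnit A₁.det ∧ A₀ᴴ = ε • A₀ ∧
        A₁ᴴ * X * T ^ 2 + A₀ * X * T + ε • (A₁ * X) = 0) ↔
      (∃ S : Matrix (Fin n ⊕ Fin n) (Fin n ⊕ Fin n) ℂ, IsUnit S.det ∧
        Sᴴ = -(ε • S) ∧ T * S * Tᴴ = S ∧ X * S * Xᴴ = 0)) ∧
    (∀ S : Matrix (Fin n ⊕ Fin n) (Fin n ⊕ Fin n) ℂ, IsUnit S.det →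
      Sᴴ = -(ε • S) → T * S * Tᴴ = S → X * S * Xᴴ = 0 →
      IsUnit (X * T⁻¹ * S * Xᴴ).det ∧
      ∀ A₁ A₀ : Matrix (Fin n) (Fin n) ℂ,
        A₁ = ε • (X * T⁻¹ * S * Xᴴ)⁻¹ →
        A₀ = -(A₁ * X * (T ^ 2)⁻¹ * S * Xᴴ * A₁) →
        IsUnit A₁.det ∧ A₀ᴴ = ε • A₀ ∧
        A₁ᴴ * X * T ^ 2 + A₀ * X * T + ε • (A₁ * X) = 0) := by
  have hε2 : ε * ε = 1 := by rcases hε with rfl | rfl <;> norm_num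
  have hεs : star ε = ε := by rcases hε with rfl | rfl <;> simp
  refine ⟨⟨?_, ?_⟩, ?_⟩
  · rintro ⟨A₁, A₀, hA₁, hA₀, hE⟩
    exact StarPalindromic.exists_of_isSolution hε2 hεs hT hW hA₁ hA₀ hE
  · rintro ⟨S, hSu, hSs, hS, hX⟩
    exact ⟨_, _, StarPalindromic.isSolution_of_isUnit hε2 hεs hT hW hSu hSs hS hX rfl rfl⟩
  · intro S hSu hSs hS hX
    exact ⟨StarPalindromic.isUnit_det_mul_inv_mul_mul_conjTranspose hT hW hSu hS hX,
      fun A₁ A₀ h₁ h₀ =>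
        StarPalindromic.isSolution_of_isUnit hε2 hεs hT hW hSu hSs hS hX h₁ h₀⟩
end

section
/- Let ε = 1 or ε = −1, let X ∈ ℂ^{n×2n} and let T ∈ ℂ^{2n×2n} be invertible such that W = [X; −XT⁻¹] is invertible. Then there exist an invertible A₁ ∈ ℂ^{n×n} and A₀ ∈ ℂ^{n×n} with A₀ᵀ = εA₀ satisfying A₁ᵀXT² + A₀XT + εA₁X = 0 if and only if there exists an invertible S ∈ ℂ^{2n×2n} with Sᵀ = −εS, TSTᵀ = S, and XSXᵀ = 0. Moreover, for any such invertible S, the matrix XT⁻¹SXᵀ is invertible, and A₁ := ε(XT⁻¹SXᵀ)⁻¹, A₀ := −A₁XT⁻²SXᵀA₁ give such a solution (A₀ᵀ = εA₀ and A₁ᵀXT² + A₀XT + εA₁X = 0). -/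
open Matrix

/-- If `[X; -Y]` is invertible, every matrix `Z` is a combination `P * X + Q * Y`. -/
theorem Matrix.exists_eq_mul_add_mul_of_isUnit_det_fromRows {m R : Type*} [Fintype m]
    [DecidableEq m] [CommRing R] {X Y : Matrix m (m ⊕ m) R}
    (hW : IsUnit (fromRows X (-Y)).det) (Z : Matrix m (m ⊕ m) R) :
    ∃ P Q : Matrix m m R, Z = P * X + Q * Y := by
  refine ⟨(Z * (fromRows X (-Y))⁻¹).toCols₁, -(Z * (fromRows X (-Y))⁻¹).toCols₂, ?_⟩
  have h : Z = Z * (fromRows X (-Y))⁻¹ * fromRows X (-Y) :=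
    (nonsing_inv_mul_cancel_right _ _ hW).symm
  rw [← fromCols_toCols (Z * (fromRows X (-Y))⁻¹), fromCols_mul_fromRows] at h
  simpa using h

/-- Congruence by `[X; -XT⁻¹]` turns a `T`-invariant form isotropic on `X` into an
anti-diagonal one, whose lower left block is therefore invertible. -/
theorem Matrix.isUnit_det_mul_inv_mul_mul_transpose {m R : Type*} [Fintype m]
    [DecidableEq m] [CommRing R] {X : Matrix m (m ⊕ m) R}
    {T S : Matrix (m ⊕ m) (m ⊕ m) R} (hT : IsUnit T.det)
    (hW : IsUnit (fromRows X (-(X * T⁻¹))).det) (hS : IsUnit S.det)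
    (hTS : T * S * Tᵀ = S) (hX : X * S * Xᵀ = 0) :
    IsUnit (X * T⁻¹ * S * Xᵀ).det := by
  have hTt : IsUnit (Tᵀ).det := by rwa [det_transpose]
  have hinv : T⁻¹ * S * (T⁻¹)ᵀ = S := by
    rw [transpose_nonsing_inv]
    nth_rewrite 1 [← hTS]
    rw [Matrix.mul_assoc T, nonsing_inv_mul_cancel_left _ _ hT,
      mul_nonsing_inv_cancel_right _ _ hTt]
  have hblock : fromRows X (-(X * T⁻¹)) * S * (fromRows X (-(X * T⁻¹)))ᵀ =
      fromBlocks 0 (-(X * S * (X * T⁻¹)ᵀ)) (-(X * T⁻¹ * S * Xᵀ)) 0 := by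
    have h : X * T⁻¹ * S * (X * T⁻¹)ᵀ = 0 := by
      calc X * T⁻¹ * S * (X * T⁻¹)ᵀ = X * (T⁻¹ * S * (T⁻¹)ᵀ) * Xᵀ := by
            simp only [transpose_mul, Matrix.mul_assoc]
        _ = 0 := by rw [hinv, hX]
    rw [transpose_fromRows, fromRows_mul, fromRows_mul_fromCols]
    rw [transpose_mul] at h
    simp [hX, h]
  have hunit : IsUnit (fromBlocks (0 : Matrix m m R) (-(X * S * (X * T⁻¹)ᵀ))
      (-(X * T⁻¹ * S * Xᵀ)) 0).det := by
    rw [← hblock, det_mul, det_mul, det_transpose]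
    exact (hW.mul hS).mul hW
  rw [← isUnit_iff_isUnit_det] at hunit ⊢
  obtain ⟨D, hD⟩ := hunit.exists_right_inv
  rw [← fromBlocks_toBlocks D, fromBlocks_multiply, ← fromBlocks_one] at hD
  have h := (fromBlocks_inj.1 hD).2.2.2
  refine (isUnit_iff_isUnit_det _).2 (isUnit_det_of_right_inverse (B := -D.toBlocks₁₂) ?_)
  simpa using h

/-- A `T`-invariant form isotropic on `X` yields a palindromic solution. -/
theorem Matrix.palindromic_solution_of_invariant_form {m R : Type*} [Fintype m]
    [DecidableEq m] [CommRing R] {ε : R} (hε : ε * ε = 1) {X : Matrix m (m ⊕ m) R}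
    {T S : Matrix (m ⊕ m) (m ⊕ m) R} (hT : IsUnit T.det)
    (hW : IsUnit (fromRows X (-(X * T⁻¹))).det)
    (hSt : Sᵀ = -(ε • S)) (hTS : T * S * Tᵀ = S) (hX : X * S * Xᵀ = 0)
    (hK : IsUnit (X * T⁻¹ * S * Xᵀ).det) {A₁ A₀ : Matrix m m R}
    (h₁ : A₁ = ε • (X * T⁻¹ * S * Xᵀ)⁻¹)
    (h₀ : A₀ = -(A₁ * X * (T ^ 2)⁻¹ * S * Xᵀ * A₁)) :
    IsUnit A₁.det ∧ A₀ᵀ = ε • A₀ ∧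
      A₁ᵀ * X * T ^ 2 + A₀ * X * T + ε • (A₁ * X) = 0 := by
  have hTt : IsUnit (Tᵀ).det := by rwa [det_transpose]
  have hTi : T⁻¹ * T = 1 := nonsing_inv_mul _ hT
  have hSTi : S * (T⁻¹)ᵀ = T * S := by
    rw [transpose_nonsing_inv]
    nth_rewrite 1 [← hTS]
    rw [mul_nonsing_inv_cancel_right _ _ hTt]
  obtain ⟨K, hKdef⟩ : ∃ K, K = X * T⁻¹ * S * Xᵀ := ⟨_, rfl⟩
  rw [← hKdef] at hK h₁
  obtain ⟨M, hMdef⟩ : ∃ M, M = X * T⁻¹ * T⁻¹ * S * Xᵀ := ⟨_, rfl⟩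
  obtain ⟨N, hNdef⟩ : ∃ N, N = X * T * S * Xᵀ := ⟨_, rfl⟩
  have hKt : Kᵀ = -(ε • N) := by
    calc Kᵀ = X * (Sᵀ * (T⁻¹)ᵀ) * Xᵀ := by
          simp only [hKdef, transpose_mul, transpose_transpose, Matrix.mul_assoc]
      _ = -(ε • N) := by
          rw [hSt, Matrix.neg_mul, Matrix.smul_mul, hSTi, hNdef]
          simp only [Matrix.mul_neg, Matrix.neg_mul, Matrix.mul_smul, Matrix.smul_mul, Matrix.mul_assoc]
  have hMt : Mᵀ = -(ε • (X * T * T * S * Xᵀ)) := by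
    calc Mᵀ = X * (Sᵀ * (T⁻¹)ᵀ * (T⁻¹)ᵀ) * Xᵀ := by
          simp only [hMdef, transpose_mul, transpose_transpose, Matrix.mul_assoc]
      _ = _ := by
          rw [hSt, Matrix.neg_mul, Matrix.smul_mul, hSTi, Matrix.neg_mul, Matrix.smul_mul, Matrix.mul_assoc T,
            hSTi]
          simp only [Matrix.mul_neg, Matrix.neg_mul, Matrix.mul_smul, Matrix.smul_mul, Matrix.mul_assoc]
  have hAK : A₁ * K = ε • 1 := by rw [h₁, Matrix.smul_mul, nonsing_inv_mul _ hK]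
  have hKA : K * A₁ = ε • 1 := by rw [h₁, Matrix.mul_smul, mul_nonsing_inv _ hK]
  have hAN : A₁ᵀ * N = -1 := by
    have h := congrArg transpose hKA
    rw [transpose_mul, hKt, transpose_smul, transpose_one, Matrix.mul_neg, Matrix.mul_smul] at h
    have h' := congrArg (fun Z => -(ε • Z)) h
    simpa [smul_smul, hε] using h'
  have hNA : N * A₁ᵀ = -1 := by
    have h := congrArg transpose hAK
    rw [transpose_mul, hKt, transpose_smul, transpose_one, Matrix.neg_mul, Matrix.smul_mul] at h
    have h' := congrArg (fun Z => -(ε • Z)) h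
    simpa [smul_smul, hε] using h'
  have hA₀ : A₀ = -(A₁ * M * A₁) := by
    rw [h₀, pow_two, mul_inv_rev, hMdef]
    simp only [Matrix.mul_assoc]
  obtain ⟨P, Q, hPQ⟩ := exists_eq_mul_add_mul_of_isUnit_det_fromRows hW (X * T)
  have hQ : N = Q * K := by
    have h := congrArg (fun Z => Z * S * Xᵀ) hPQ
    simp only [Matrix.add_mul, Matrix.mul_assoc] at h
    rw [← Matrix.mul_assoc X S, hX] at h
    simpa [hNdef, hKdef, Matrix.mul_assoc] using h
  have hP : P * K + Q * M = 0 := by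
    have h := congrArg (fun Z => Z * T⁻¹ * S * Xᵀ) hPQ
    beta_reduce at h
    rw [mul_nonsing_inv_cancel_right _ _ hT, hX] at h
    simpa [Matrix.add_mul, hMdef, hKdef, Matrix.mul_assoc] using h.symm
  have hAQ : A₁ᵀ * Q = -(ε • A₁) := by
    have h : A₁ᵀ * Q * K * A₁ = -A₁ := by
      rw [Matrix.mul_assoc A₁ᵀ, ← hQ, hAN, Matrix.neg_mul, Matrix.one_mul]
    rw [Matrix.mul_assoc _ K, hKA, Matrix.mul_smul, Matrix.mul_one] at h
    have h' := congrArg (fun Z => ε • Z) h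
    simpa [smul_smul, hε] using h'
  have hAP : A₁ᵀ * P = -A₀ := by
    have h : A₁ᵀ * (P * K + Q * M) * A₁ = 0 := by rw [hP]; simp
    rw [Matrix.mul_add, ← Matrix.mul_assoc, ← Matrix.mul_assoc, hAQ, Matrix.add_mul,
      Matrix.mul_assoc _ K, hKA] at h
    have h' := congrArg (fun Z => ε • Z) h
    simp only [Matrix.neg_mul, Matrix.mul_smul, Matrix.smul_mul, Matrix.mul_one, smul_add, smul_neg, smul_smul,
      hε, one_smul, smul_zero] at h'
    rw [hA₀, neg_neg]
    exact add_neg_eq_zero.1 h'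
  have heq : A₁ᵀ * X * T ^ 2 + A₀ * X * T + ε • (A₁ * X) = 0 := by
    have h : A₁ᵀ * X * T ^ 2 = A₁ᵀ * P * X * T + A₁ᵀ * Q * X := by
      calc A₁ᵀ * X * T ^ 2 = A₁ᵀ * (X * T) * T := by
            simp only [pow_two, Matrix.mul_assoc]
        _ = _ := by
          rw [hPQ]
          simp only [Matrix.mul_add, Matrix.add_mul, Matrix.mul_assoc, hTi, Matrix.mul_one]
    rw [h, hAP, hAQ]
    simp
  refine ⟨?_, ?_, heq⟩
  · refine isUnit_det_of_right_inverse (B := ε • K) ?_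
    rw [Matrix.mul_smul, hAK, smul_smul, hε, one_smul]
  · have h := congrArg (fun Z => Z * S * Xᵀ * A₁ᵀ) heq
    have hz : A₁ * X * S * Xᵀ = 0 := by
      rw [Matrix.mul_assoc A₁, Matrix.mul_assoc A₁, hX, Matrix.mul_zero]
    have hn : A₀ * X * T * S * Xᵀ * A₁ᵀ = -A₀ := by
      calc A₀ * X * T * S * Xᵀ * A₁ᵀ = A₀ * (N * A₁ᵀ) := by
            simp only [hNdef, Matrix.mul_assoc]
        _ = -A₀ := by rw [hNA]; simp
    simp only [Matrix.add_mul, Matrix.smul_mul, hz, hn, smul_zero, Matrix.zero_mul, add_zero] at h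
    rw [← sub_eq_add_neg, sub_eq_zero] at h
    have ht := congrArg transpose hA₀
    rw [ht, ← h, transpose_neg, transpose_mul, transpose_mul, hMt]
    simp [pow_two, Matrix.mul_assoc]

/-- A palindromic solution yields a `T`-invariant form isotropic on `X`. -/
theorem Matrix.exists_invariant_form_of_palindromic_solution {m R : Type*} [Fintype m]
    [DecidableEq m] [CommRing R] {ε : R} (hε : ε * ε = 1) {X : Matrix m (m ⊕ m) R}
    {T : Matrix (m ⊕ m) (m ⊕ m) R} (hT : IsUnit T.det)
    (hW : IsUnit (fromRows X (-(X * T⁻¹))).det) {A₁ A₀ : Matrix m m R}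
    (hA₁ : IsUnit A₁.det) (hA₀ : A₀ᵀ = ε • A₀)
    (heq : A₁ᵀ * X * T ^ 2 + A₀ * X * T + ε • (A₁ * X) = 0) :
    ∃ S : Matrix (m ⊕ m) (m ⊕ m) R, IsUnit S.det ∧
      Sᵀ = -(ε • S) ∧ T * S * Tᵀ = S ∧ X * S * Xᵀ = 0 := by
  set W := fromRows X (-(X * T⁻¹)) with hWdef
  have hWt : IsUnit (Wᵀ).det := by rwa [det_transpose]
  obtain ⟨B, hB⟩ : ∃ B : Matrix m m R, B = (A₁⁻¹)ᵀ := ⟨_, rfl⟩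
  have hBt : Bᵀ = A₁⁻¹ := by rw [hB, transpose_transpose]
  have hAB : A₁ * Bᵀ = 1 := by rw [hBt, mul_nonsing_inv _ hA₁]
  have hBA : Bᵀ * A₁ = 1 := by rw [hBt, nonsing_inv_mul _ hA₁]
  have hBA' : B * A₁ᵀ = 1 := by simpa using congrArg transpose hAB
  set J : Matrix (m ⊕ m) (m ⊕ m) R := fromBlocks 0 B (-(ε • Bᵀ)) 0 with hJ
  set C : Matrix (m ⊕ m) (m ⊕ m) R := fromBlocks (-(B * A₀)) (ε • (B * A₁)) (-1) 0 with hC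
  have hJt : Jᵀ = -(ε • J) := by
    simp [hJ, fromBlocks_transpose, fromBlocks_smul, fromBlocks_neg, smul_smul, hε]
  have hJu : IsUnit J.det := by
    refine isUnit_det_of_right_inverse (B := fromBlocks 0 (-(ε • A₁)) A₁ᵀ 0) ?_
    simp [hJ, fromBlocks_multiply, smul_smul, hε, hBA, hBA']
  have hCJ : C * J * Cᵀ = J := by
    have h₁ : C * J = fromBlocks (-B) (-(B * A₀ * B)) 0 (-B) := by
      simp [hC, hJ, fromBlocks_multiply, smul_smul, hε, Matrix.mul_assoc, hAB]
    rw [h₁, hC, hJ, fromBlocks_transpose, fromBlocks_multiply]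
    simp [hA₀, Matrix.mul_assoc, ← Matrix.mul_assoc B A₁ᵀ, hBA']
  have hWT : W * T = C * W := by
    have hx : X * T = -(B * A₀ * X) - ε • (B * A₁ * (X * T⁻¹)) := by
      have h := congrArg (fun Z => B * (Z * T⁻¹)) heq
      simp only [pow_two, ← Matrix.mul_assoc, Matrix.add_mul, Matrix.mul_add, Matrix.smul_mul, Matrix.mul_smul,
        mul_nonsing_inv_cancel_right _ _ hT, hBA', Matrix.one_mul, Matrix.zero_mul,
        Matrix.mul_zero] at h
      rw [← Matrix.mul_assoc (B * A₁)]
      rw [← sub_eq_zero, ← h]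
      abel
    rw [hWdef, hC, fromRows_mul, fromBlocks_mul_fromRows]
    congr 1
    · rw [hx]
      simp [sub_eq_add_neg]
    · simp [nonsing_inv_mul_cancel_right _ _ hT]
  refine ⟨W⁻¹ * J * (W⁻¹)ᵀ, ?_, ?_, ?_, ?_⟩
  · rw [det_mul, det_mul, det_transpose]
    have hWi := W.isUnit_nonsing_inv_det hW
    exact (hWi.mul hJu).mul hWi
  · rw [transpose_mul, transpose_mul, transpose_transpose, hJt]
    simp [Matrix.mul_assoc]
  · have hTW : T * W⁻¹ = W⁻¹ * C := by
      rw [← nonsing_inv_mul_cancel_left W (T * W⁻¹) hW, ← Matrix.mul_assoc W, hWT,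
        mul_nonsing_inv_cancel_right _ _ hW]
    calc T * (W⁻¹ * J * (W⁻¹)ᵀ) * Tᵀ = (T * W⁻¹) * J * (T * W⁻¹)ᵀ := by
          simp only [transpose_mul, Matrix.mul_assoc]
      _ = W⁻¹ * (C * J * Cᵀ) * (W⁻¹)ᵀ := by
          rw [hTW]
          simp only [transpose_mul, Matrix.mul_assoc]
      _ = _ := by rw [hCJ]
  · have h : W * (W⁻¹ * J * (W⁻¹)ᵀ) * Wᵀ = J := by
      rw [transpose_nonsing_inv, Matrix.mul_assoc W⁻¹, mul_nonsing_inv_cancel_left _ _ hW,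
        nonsing_inv_mul_cancel_right _ _ hWt]
    rw [hWdef, transpose_fromRows, fromRows_mul, fromRows_mul_fromCols, ← hWdef, hJ] at h
    exact (fromBlocks_inj.1 h).1

/-- Solvability of the inverse eigenvalue problem IEP-QP(2n) for
*-(anti)-palindromic systems: a regular solution exists iff there is an
invertible `S` with `Sᵀ = -εS`, `TSTᵀ = S`, `XSXᵀ = 0`; and any such `S`
yields a solution via `A₁ = ε(XT⁻¹SXᵀ)⁻¹`, `A₀ = -A₁XT⁻²SXᵀA₁`. -/
theorem iep_qp_2n_top_palindromic {n : ℕ} (ε : ℂ) (hε : ε = 1 ∨ ε = -1)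
    (X : Matrix (Fin n) (Fin n ⊕ Fin n) ℂ)
    (T : Matrix (Fin n ⊕ Fin n) (Fin n ⊕ Fin n) ℂ) (hT : IsUnit T.det)
    (hW : IsUnit (Matrix.fromRows X (-(X * T⁻¹))).det) :
    ((∃ A₁ A₀ : Matrix (Fin n) (Fin n) ℂ, IsUnit A₁.det ∧ A₀ᵀ = ε • A₀ ∧
        A₁ᵀ * X * T ^ 2 + A₀ * X * T + ε • (A₁ * X) = 0) ↔
      (∃ S : Matrix (Fin n ⊕ Fin n) (Fin n ⊕ Fin n) ℂ, IsUnit S.det ∧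
        Sᵀ = -(ε • S) ∧ T * S * Tᵀ = S ∧ X * S * Xᵀ = 0)) ∧
    (∀ S : Matrix (Fin n ⊕ Fin n) (Fin n ⊕ Fin n) ℂ, IsUnit S.det →
      Sᵀ = -(ε • S) → T * S * Tᵀ = S → X * S * Xᵀ = 0 →
      IsUnit (X * T⁻¹ * S * Xᵀ).det ∧
      ∀ A₁ A₀ : Matrix (Fin n) (Fin n) ℂ,
        A₁ = ε • (X * T⁻¹ * S * Xᵀ)⁻¹ →
        A₀ = -(A₁ * X * (T ^ 2)⁻¹ * S * Xᵀ * A₁) →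
        IsUnit A₁.det ∧ A₀ᵀ = ε • A₀ ∧
        A₁ᵀ * X * T ^ 2 + A₀ * X * T + ε • (A₁ * X) = 0) := by
  have hε' : ε * ε = 1 := by rcases hε with rfl | rfl <;> norm_num
  refine ⟨⟨?_, ?_⟩, ?_⟩
  · rintro ⟨A₁, A₀, hA₁, hA₀, heq⟩
    exact exists_invariant_form_of_palindromic_solution hε' hT hW hA₁ hA₀ heq
  · rintro ⟨S, hS, hSt, hTS, hX⟩
    exact ⟨_, _, palindromic_solution_of_invariant_form hε' hT hW hSt hTS hX
      (isUnit_det_mul_inv_mul_mul_transpose hT hW hS hTS hX) rfl rfl⟩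
  · intro S hS hSt hTS hX
    have hK := isUnit_det_mul_inv_mul_mul_transpose hT hW hS hTS hX
    exact ⟨hK, fun A₁ A₀ h₁ h₀ =>
      palindromic_solution_of_invariant_form hε' hT hW hSt hTS hX hK h₁ h₀⟩
end

section
/- Let ε = 1 or ε = −1, let X ∈ ℂ^{n×2n}, let T ∈ ℂ^{2n×2n} be invertible with W = [X; −XT⁻¹] invertible, and let S, S̃ ∈ ℂ^{2n×2n} both be invertible and satisfy Sᴴ = −εS, TSTᴴ = S, XSXᴴ = 0 and S̃ᴴ = −εS̃, TS̃Tᴴ = S̃, XS̃Xᴴ = 0. Then for every μ ∈ ℂ, the multiplicity of μ as a root of the characteristic polynomial of S̃S⁻¹ equals the multiplicity of the complex conjugate μ̄ as a root of that polynomial; and if μ is real (μ = μ̄), then this multiplicity is even. -/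
open Matrix Polynomial

/-- If `X * S * Xᴴ = 0` and `T * S * Tᴴ = S`, then congruence with `[X; -X * T⁻¹]` makes `S`
block anti-diagonal, with the two blocks related by conjugate transposition. -/
theorem fromRows_congruence_eq_fromBlocks {n : ℕ} {ε : ℂ} (hε : ε = 1 ∨ ε = -1)
    (X : Matrix (Fin n) (Fin n ⊕ Fin n) ℂ)
    (T : Matrix (Fin n ⊕ Fin n) (Fin n ⊕ Fin n) ℂ) (hT : IsUnit T.det)
    (S : Matrix (Fin n ⊕ Fin n) (Fin n ⊕ Fin n) ℂ)
    (hSh : Sᴴ = -(ε • S)) (hST : T * S * Tᴴ = S) (hSX : X * S * Xᴴ = 0) :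
    ∃ A : Matrix (Fin n) (Fin n) ℂ,
      fromRows X (-(X * T⁻¹)) * S * (fromRows X (-(X * T⁻¹)))ᴴ =
        fromBlocks 0 A (-(ε • Aᴴ)) 0 := by
  have hS : T⁻¹ * S * (T⁻¹)ᴴ = S := by
    have hTT : Tᴴ * (T⁻¹)ᴴ = 1 := by
      rw [← conjTranspose_mul, nonsing_inv_mul T hT, conjTranspose_one]
    calc T⁻¹ * S * (T⁻¹)ᴴ = T⁻¹ * (T * S * Tᴴ) * (T⁻¹)ᴴ := by rw [hST]
      _ = (T⁻¹ * T) * S * (Tᴴ * (T⁻¹)ᴴ) := by simp only [Matrix.mul_assoc]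
      _ = S := by rw [nonsing_inv_mul T hT, hTT, Matrix.one_mul, Matrix.mul_one]
  refine ⟨-(X * S * (X * T⁻¹)ᴴ), ?_⟩
  rw [conjTranspose_fromRows_eq_fromCols_conjTranspose, fromRows_mul, fromRows_mul_fromCols,
    fromBlocks_inj]
  refine ⟨hSX, by simp, ?_, ?_⟩
  · rw [conjTranspose_neg, conjTranspose_mul (X * S), conjTranspose_conjTranspose,
      conjTranspose_mul X S, hSh]
    rcases hε with rfl | rfl <;> simp [Matrix.mul_assoc]
  · calc -(X * T⁻¹) * S * (-(X * T⁻¹))ᴴ = X * (T⁻¹ * S * (T⁻¹)ᴴ) * Xᴴ := by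
          simp [conjTranspose_mul, Matrix.mul_assoc]
      _ = 0 := by rw [hS, hSX]

/-- The characteristic polynomial of a conjugate transpose has conjugated coefficients. -/
theorem charpoly_conjTranspose_eq_map {n : Type*} [Fintype n] [DecidableEq n]
    (A : Matrix n n ℂ) : Aᴴ.charpoly = A.charpoly.map (starRingEnd ℂ) := by
  rw [← charpoly_transpose A, ← charpoly_map]
  rfl

/-- For block anti-diagonal `(-ε)`-Hermitian matrices, the characteristic polynomial of the
quotient is a polynomial times its conjugate. -/
theorem exists_charpoly_eq_mul_map_conj {n : Type*} [Fintype n] [DecidableEq n] (ε : ℂ)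
    (A A' : Matrix n n ℂ) (L : Matrix (n ⊕ n) (n ⊕ n) ℂ)
    (hL : fromBlocks 0 A (-(ε • Aᴴ)) 0 * L = 1) :
    ∃ B : Matrix n n ℂ, (fromBlocks 0 A' (-(ε • A'ᴴ)) 0 * L).charpoly =
      B.charpoly * B.charpoly.map (starRingEnd ℂ) := by
  obtain ⟨a, b, c, d, rfl⟩ : ∃ a b c d, L = fromBlocks a b c d :=
    ⟨_, _, _, _, (fromBlocks_toBlocks L).symm⟩
  rw [fromBlocks_multiply, ← fromBlocks_one, fromBlocks_inj] at hL
  simp only [Matrix.zero_mul, zero_add, add_zero] at hL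
  obtain ⟨hc, hd, -, hb⟩ := hL
  have hcA : c * A = 1 := mul_eq_one_comm.mp hc
  have hd0 : d = 0 := by
    rw [← Matrix.one_mul d, ← hcA, Matrix.mul_assoc, hd, Matrix.mul_zero]
  have hbc : -(ε • b) = cᴴ := by
    have h1 : Aᴴ * -(ε • b) = 1 := by rw [← hb]; simp
    have h2 : cᴴ * Aᴴ = 1 := by rw [← conjTranspose_mul, hc, conjTranspose_one]
    rw [← Matrix.one_mul (-(ε • b)), ← h2, Matrix.mul_assoc, h1, Matrix.mul_one]
  have hB : -(ε • A'ᴴ) * b = (c * A')ᴴ := by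
    rw [conjTranspose_mul, ← hbc]; simp
  refine ⟨A' * c, ?_⟩
  rw [fromBlocks_multiply, hB, hd0]
  simp only [Matrix.zero_mul, zero_add, add_zero, Matrix.mul_zero]
  rw [charpoly_fromBlocks_zero₁₂, charpoly_conjTranspose_eq_map, charpoly_mul_comm c A']

/-- For two invertible matrices `S`, `S̃` in `S_{(X,T)}` (conjugate-transpose
case), the eigenvalues of `S̃S⁻¹` have the pairing `(μ, μ̄)` with equal
algebraic multiplicities, and eigenvalues with `μ = μ̄` have even
algebraic multiplicity. -/
theorem eigenvalue_pairing_star_case {n : ℕ} (ε : ℂ) (hε : ε = 1 ∨ ε = -1)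
    (X : Matrix (Fin n) (Fin n ⊕ Fin n) ℂ)
    (T : Matrix (Fin n ⊕ Fin n) (Fin n ⊕ Fin n) ℂ) (hT : IsUnit T.det)
    (hW : IsUnit (Matrix.fromRows X (-(X * T⁻¹))).det)
    (S S' : Matrix (Fin n ⊕ Fin n) (Fin n ⊕ Fin n) ℂ)
    (hSu : IsUnit S.det) (hSh : Sᴴ = -(ε • S)) (hST : T * S * Tᴴ = S)
    (hSX : X * S * Xᴴ = 0)
    (hS'u : IsUnit S'.det) (hS'h : S'ᴴ = -(ε • S')) (hS'T : T * S' * Tᴴ = S')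
    (hS'X : X * S' * Xᴴ = 0) :
    ∀ μ : ℂ,
      (S' * S⁻¹).charpoly.rootMultiplicity μ =
        (S' * S⁻¹).charpoly.rootMultiplicity (starRingEnd ℂ μ) ∧
      (μ = starRingEnd ℂ μ →
        Even ((S' * S⁻¹).charpoly.rootMultiplicity μ)) := by
  obtain ⟨A, hA⟩ := fromRows_congruence_eq_fromBlocks hε X T hT S hSh hST hSX
  obtain ⟨A', hA'⟩ := fromRows_congruence_eq_fromBlocks hε X T hT S' hS'h hS'T hS'X
  set W := fromRows X (-(X * T⁻¹))
  have hWW : Wᴴ * (W⁻¹)ᴴ = 1 := by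
    rw [← conjTranspose_mul, nonsing_inv_mul W hW, conjTranspose_one]
  have hL : fromBlocks 0 A (-(ε • Aᴴ)) 0 * ((W⁻¹)ᴴ * S⁻¹ * W⁻¹) = 1 := by
    calc _ = W * (S * (Wᴴ * (W⁻¹)ᴴ) * S⁻¹) * W⁻¹ := by rw [← hA]; simp only [Matrix.mul_assoc]
      _ = 1 := by
        rw [hWW, Matrix.mul_one, mul_nonsing_inv S hSu, Matrix.mul_one, mul_nonsing_inv W hW]
  obtain ⟨B, hB⟩ := exists_charpoly_eq_mul_map_conj ε A A' _ hL
  have hchar : (S' * S⁻¹).charpoly = B.charpoly * B.charpoly.map (starRingEnd ℂ) := by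
    rw [← hB, ← hA']
    calc _ = (W⁻¹ * (W * (S' * S⁻¹))).charpoly := by
          rw [← Matrix.mul_assoc, nonsing_inv_mul W hW, Matrix.one_mul]
      _ = (W * (S' * (Wᴴ * (W⁻¹)ᴴ) * S⁻¹) * W⁻¹).charpoly := by
          rw [charpoly_mul_comm, hWW, Matrix.mul_one]
      _ = _ := by simp only [Matrix.mul_assoc]
  have hmap (z : ℂ) : (B.charpoly.map (starRingEnd ℂ)).rootMultiplicity (starRingEnd ℂ z) =
      B.charpoly.rootMultiplicity z :=
    (eq_rootMultiplicity_map (starRingEnd ℂ).injective z).symm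
  have hmult (z : ℂ) : (S' * S⁻¹).charpoly.rootMultiplicity z =
      B.charpoly.rootMultiplicity z + B.charpoly.rootMultiplicity (starRingEnd ℂ z) := by
    rw [hchar, rootMultiplicity_mul (hchar ▸ (charpoly_monic _).ne_zero),
      ← hmap (starRingEnd ℂ z), Complex.conj_conj]
  intro μ
  refine ⟨?_, fun hμ => ?_⟩
  · rw [hmult, hmult, Complex.conj_conj, add_comm]
  · rw [hmult, ← hμ]
    exact ⟨_, rfl⟩
end

section
/- Let ε = 1 or ε = −1, let X ∈ ℂ^{n×2n}, let T ∈ ℂ^{2n×2n} be invertible with W = [X; −XT⁻¹] invertible, and let S, S̃ ∈ ℂ^{2n×2n} both be invertible and satisfy Sᵀ = −εS, TSTᵀ = S, XSXᵀ = 0 and S̃ᵀ = −εS̃, TS̃Tᵀ = S̃, XS̃Xᵀ = 0. Then every μ ∈ ℂ has even multiplicity as a root of the characteristic polynomial of S̃S⁻¹. -/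
open Matrix Polynomial

/-- Congruence by `W = [X; -XT⁻¹]` brings an `S` in `S_{(X,T)}` to block anti-diagonal form. -/
theorem exists_antidiagonal_congruence {K n : Type*} [Field K] [Fintype n] [DecidableEq n]
    (ε : K) (X : Matrix n (n ⊕ n) K) (T : Matrix (n ⊕ n) (n ⊕ n) K) (hT : IsUnit T.det)
    (S : Matrix (n ⊕ n) (n ⊕ n) K) (hSh : Sᵀ = -(ε • S)) (hST : T * S * Tᵀ = S)
    (hSX : X * S * Xᵀ = 0) :
    ∃ B : Matrix n n K, fromRows X (-(X * T⁻¹)) * S * (fromRows X (-(X * T⁻¹)))ᵀ =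
      fromBlocks 0 B (-(ε • Bᵀ)) 0 := by
  have hTS : T⁻¹ * S * T⁻¹ᵀ = S := by
    conv_lhs => rw [← hST]
    have h : Tᵀ * T⁻¹ᵀ = 1 := by
      rw [← transpose_mul, nonsing_inv_mul T hT, transpose_one]
    rw [Matrix.mul_assoc, Matrix.mul_assoc (T * S), h, Matrix.mul_one, ← Matrix.mul_assoc,
      nonsing_inv_mul T hT, Matrix.one_mul]
  refine ⟨X * S * (-(X * T⁻¹))ᵀ, ?_⟩
  rw [transpose_fromRows, fromRows_mul, fromRows_mul_fromCols, hSX]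
  congr 1
  · have hS : S = -(ε • Sᵀ) := by
      have h := congrArg transpose hSh
      rwa [transpose_transpose, transpose_neg, transpose_smul] at h
    conv_lhs => rw [hS]
    simp only [transpose_mul, transpose_neg, Matrix.neg_mul, Matrix.mul_neg, Matrix.smul_mul,
      Matrix.mul_smul, Matrix.mul_assoc, transpose_transpose, neg_neg, smul_neg]
  · calc -(X * T⁻¹) * S * (-(X * T⁻¹))ᵀ = X * (T⁻¹ * S * T⁻¹ᵀ) * Xᵀ := by
          simp only [transpose_neg, transpose_mul, Matrix.neg_mul, Matrix.mul_neg, neg_neg,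
            Matrix.mul_assoc]
      _ = 0 := by rw [hTS, hSX]

/-- If a block anti-diagonal matrix is invertible, so is its upper right block. -/
theorem isUnit_det_of_fromBlocks_antidiagonal {K n : Type*} [Field K] [Fintype n] [DecidableEq n]
    (B C : Matrix n n K) (h : IsUnit (fromBlocks 0 B C 0).det) : IsUnit B.det := by
  have h1 := mul_nonsing_inv _ h
  rw [← fromBlocks_toBlocks (fromBlocks 0 B C 0)⁻¹, fromBlocks_multiply, ← fromBlocks_one,
    fromBlocks_inj] at h1
  have h2 := h1.1
  rw [Matrix.zero_mul, zero_add] at h2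
  exact isUnit_det_of_right_inverse h2

/-- For two invertible matrices `S`, `S̃` in `S_{(X,T)}` (transpose case),
every eigenvalue of `S̃S⁻¹` has even algebraic multiplicity. -/
theorem eigenvalue_even_multiplicity_top_case {n : ℕ} (ε : ℂ)
    (hε : ε = 1 ∨ ε = -1)
    (X : Matrix (Fin n) (Fin n ⊕ Fin n) ℂ)
    (T : Matrix (Fin n ⊕ Fin n) (Fin n ⊕ Fin n) ℂ) (hT : IsUnit T.det)
    (hW : IsUnit (Matrix.fromRows X (-(X * T⁻¹))).det)
    (S S' : Matrix (Fin n ⊕ Fin n) (Fin n ⊕ Fin n) ℂ)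
    (hSu : IsUnit S.det) (hSh : Sᵀ = -(ε • S)) (hST : T * S * Tᵀ = S)
    (hSX : X * S * Xᵀ = 0)
    (hS'u : IsUnit S'.det) (hS'h : S'ᵀ = -(ε • S')) (hS'T : T * S' * Tᵀ = S')
    (hS'X : X * S' * Xᵀ = 0) :
    ∀ μ : ℂ, Even ((S' * S⁻¹).charpoly.rootMultiplicity μ) := by
  obtain ⟨B, hB⟩ := exists_antidiagonal_congruence ε X T hT S hSh hST hSX
  obtain ⟨B', hB'⟩ := exists_antidiagonal_congruence ε X T hT S' hS'h hS'T hS'X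
  set W := fromRows X (-(X * T⁻¹)) with hWdef
  have hBu : IsUnit B.det := by
    apply isUnit_det_of_fromBlocks_antidiagonal B (-(ε • Bᵀ))
    rw [← hB, det_mul, det_mul, det_transpose]
    exact (hW.mul hSu).mul hW
  have hWT : IsUnit Wᵀ.det := by rwa [det_transpose]
  set D := fromBlocks (B' * B⁻¹) 0 0 (B⁻¹ * B')ᵀ with hD
  have hDK : D * (W * S * Wᵀ) = W * S' * Wᵀ := by
    have h : (B⁻¹)ᵀ * Bᵀ = 1 := by
      rw [← transpose_mul, mul_nonsing_inv B hBu, transpose_one]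
    rw [hB, hB', hD, fromBlocks_multiply]
    simp [Matrix.mul_assoc, nonsing_inv_mul B hBu, h]
  have hDS : D * W * S = W * S' := by
    have h := congrArg (· * Wᵀ⁻¹) hDK
    simpa only [← Matrix.mul_assoc, mul_nonsing_inv_cancel_right _ _ hWT] using h
  have hconj : S' * S⁻¹ = W⁻¹ * D * W := by
    have h : W * (S' * S⁻¹) = D * W := by
      rw [← Matrix.mul_assoc, ← hDS, mul_nonsing_inv_cancel_right _ _ hSu]
    rw [Matrix.mul_assoc, ← h, nonsing_inv_mul_cancel_left _ _ hW]
  have hchar : (S' * S⁻¹).charpoly = (B' * B⁻¹).charpoly * (B' * B⁻¹).charpoly := by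
    rw [hconj, Matrix.mul_assoc, charpoly_mul_comm, mul_nonsing_inv_cancel_right _ _ hW, hD,
      charpoly_fromBlocks_zero₁₂, charpoly_transpose, charpoly_mul_comm B⁻¹]
  intro μ
  have hne := (charpoly_monic (B' * B⁻¹)).ne_zero
  rw [hchar, rootMultiplicity_mul (mul_ne_zero hne hne)]
  exact ⟨_, rfl⟩
end

section
/- Let λ ∈ ℂ with λ ≠ 0, let N ∈ ℂ^{m×m} be the nilpotent Jordan block (N has ones on the superdiagonal, i.e. N_{i,i+1} = 1 for 1 ≤ i ≤ m−1, and all other entries zero), and set J = λI_m + N. Suppose S, S̃ ∈ ℂ^{m×m} satisfy S = JSJᴴ and S̃ = JS̃Jᴴ, with S̃ invertible. Then M := S̃⁻¹S is a lower triangular Toeplitz matrix: M_{ij} = 0 whenever i < j, and M_{i+1, j+1} = M_{ij} for all 1 ≤ i, j ≤ m−1. -/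
open Matrix

/-- If `S` and an invertible `S'` are both fixed by the congruence `X ↦ J X Jᴴ`, then `Jᴴ` commutes
with `S'⁻¹ S`. -/
lemma commute_conjTranspose_inv_mul {n R : Type*} [Fintype n] [DecidableEq n] [CommRing R]
    [StarRing R] {J S S' : Matrix n n R} (hS : S = J * S * Jᴴ) (hS' : S' = J * S' * Jᴴ)
    (hS'u : IsUnit S'.det) : Commute Jᴴ (S'⁻¹ * S) := by
  have hu : IsUnit (J * S').det := by
    rw [hS', det_mul] at hS'u
    exact isUnit_of_mul_isUnit_left hS'u
  have hM : S' * (S'⁻¹ * S) = S := mul_nonsing_inv_cancel_left S' S hS'u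
  have key : J * S' * (Jᴴ * (S'⁻¹ * S)) = J * S' * (S'⁻¹ * S * Jᴴ) := by
    calc J * S' * (Jᴴ * (S'⁻¹ * S)) = J * S' * Jᴴ * (S'⁻¹ * S) := (Matrix.mul_assoc _ _ _).symm
      _ = J * (S' * (S'⁻¹ * S)) * Jᴴ := by rw [← hS', hM, ← hS]
      _ = J * S' * (S'⁻¹ * S * Jᴴ) := by simp only [Matrix.mul_assoc]
  exact ((isUnit_iff_isUnit_det _).2 hu).mul_left_cancel key

/-- A matrix commuting with the lower shift matrix is lower triangular Toeplitz. -/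
lemma lower_triangular_toeplitz_of_commute_shift {m : ℕ} {R : Type*} [CommRing R]
    {L M : Matrix (Fin m) (Fin m) R}
    (hL : ∀ i j : Fin m, L i j = if (j : ℕ) + 1 = (i : ℕ) then 1 else 0) (h : Commute L M) :
    (∀ i j : Fin m, (i : ℕ) < (j : ℕ) → M i j = 0) ∧
    (∀ (i j : Fin m) (hi : (i : ℕ) + 1 < m) (hj : (j : ℕ) + 1 < m),
      M ⟨(i : ℕ) + 1, hi⟩ ⟨(j : ℕ) + 1, hj⟩ = M i j) := by
  have right (i j : Fin m) (hj : (j : ℕ) + 1 < m) : (M * L) i j = M i ⟨j + 1, hj⟩ := by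
    rw [mul_apply, Finset.sum_eq_single ⟨j + 1, hj⟩]
    · simp [hL]
    · intro k _ hk
      rw [hL, if_neg fun e => hk (Fin.ext e.symm), mul_zero]
    · simp
  have left (i j : Fin m) (hi : (i : ℕ) + 1 < m) : (L * M) ⟨i + 1, hi⟩ j = M i j := by
    rw [mul_apply, Finset.sum_eq_single i]
    · simp [hL]
    · intro k _ hk
      rw [hL, if_neg fun e => hk (Fin.ext (Nat.succ_injective e)), zero_mul]
    · simp
  have toeplitz (i j : Fin m) (hi : (i : ℕ) + 1 < m) (hj : (j : ℕ) + 1 < m) :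
      M ⟨i + 1, hi⟩ ⟨j + 1, hj⟩ = M i j := by
    rw [← right, ← h.eq, left]
  refine ⟨?_, toeplitz⟩
  rintro ⟨i, hi⟩ ⟨j, hj⟩ hij
  simp only at hij
  induction i generalizing j with
  | zero =>
    obtain ⟨j, rfl⟩ := Nat.exists_eq_succ_of_ne_zero hij.ne'
    rw [← right ⟨0, hi⟩ ⟨j, by omega⟩ hj, ← h.eq, mul_apply]
    exact Finset.sum_eq_zero fun k _ => by simp [hL]
  | succ i ih =>
    obtain ⟨j, rfl⟩ := Nat.exists_eq_succ_of_ne_zero (Nat.ne_zero_of_lt hij)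
    rw [toeplitz ⟨i, by omega⟩ ⟨j, by omega⟩ hi hj]
    exact ih _ _ _ (by omega)

/-- If `J = λI + N` with `N` the nilpotent Jordan block, `S = JSJᴴ`,
`S̃ = JS̃Jᴴ` and `S̃` invertible, then `S̃⁻¹S` is a lower triangular
Toeplitz matrix. -/
theorem inv_mul_lower_triangular_toeplitz {m : ℕ} (lam : ℂ) (hlam : lam ≠ 0)
    (N : Matrix (Fin m) (Fin m) ℂ)
    (hN : ∀ i j : Fin m, N i j = if (i : ℕ) + 1 = (j : ℕ) then 1 else 0)
    (J : Matrix (Fin m) (Fin m) ℂ) (hJ : J = lam • (1 : Matrix (Fin m) (Fin m) ℂ) + N)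
    (S S' : Matrix (Fin m) (Fin m) ℂ)
    (hS : S = J * S * Jᴴ) (hS' : S' = J * S' * Jᴴ)
    (hS'u : IsUnit S'.det)
    (M : Matrix (Fin m) (Fin m) ℂ) (hM : M = S'⁻¹ * S) :
    (∀ i j : Fin m, (i : ℕ) < (j : ℕ) → M i j = 0) ∧
    (∀ (i j : Fin m) (hi : (i : ℕ) + 1 < m) (hj : (j : ℕ) + 1 < m),
      M ⟨(i : ℕ) + 1, hi⟩ ⟨(j : ℕ) + 1, hj⟩ = M i j) := by
  have h := commute_conjTranspose_inv_mul hS hS' hS'u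
  rw [← hM] at h
  refine lower_triangular_toeplitz_of_commute_shift (L := Nᴴ) (fun i j => ?_) ?_
  · rw [conjTranspose_apply, hN]
    split_ifs <;> simp
  · have hN' : Nᴴ = Jᴴ - star lam • (1 : Matrix (Fin m) (Fin m) ℂ) := by
      rw [hJ, conjTranspose_add, conjTranspose_smul, conjTranspose_one, add_sub_cancel_left]
    rw [hN']
    exact h.sub_left ((Commute.one_left M).smul_left _)
end

section
/- Let T₁ ∈ ℂ^{k×k} and T₂ ∈ ℂ^{m×m} be invertible matrices such that no μ ∈ ℂ is a root of both the characteristic polynomial of T₁ and the characteristic polynomial of T₂, and such that T₁ is similar to (T₁ᴴ)⁻¹ (i.e., there exists an invertible P with P⁻¹T₁P = (T₁ᴴ)⁻¹). Let T = diag(T₁, T₂) be the (k+m)×(k+m) block diagonal matrix, and let S ∈ ℂ^{(k+m)×(k+m)}, partitioned conformally as S = [[S₁₁, S₁₂],[S₂₁, S₂₂]], satisfy S = TSTᴴ. Then S₁₂ = 0 and S₂₁ = 0, i.e., S is block diagonal: S = diag(S₁₁, S₂₂). -/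
open Matrix Polynomial

theorem Matrix.aeval_mul_eq_mul_aeval_of_intertwines {R k m : Type*} [CommRing R]
    [Fintype k] [DecidableEq k] [Fintype m] [DecidableEq m]
    {A : Matrix k k R} {B : Matrix m m R} {Y : Matrix m k R} (h : B * Y = Y * A) (p : R[X]) :
    aeval B p * Y = Y * aeval A p := by
  induction p using Polynomial.induction_on with
  | C a => simp [Algebra.algebraMap_eq_smul_one]
  | add p q hp hq => simp only [map_add, Matrix.add_mul, Matrix.mul_add, hp, hq]
  | monomial n a ih =>
    rw [pow_succ, ← mul_assoc, map_mul _ _ X, map_mul _ _ X, aeval_X, aeval_X, Matrix.mul_assoc, h,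
      ← Matrix.mul_assoc, ih, Matrix.mul_assoc]

/-- The homogeneous Sylvester equation has only the trivial solution when the characteristic
polynomials are coprime. -/
theorem Matrix.eq_zero_of_intertwines_of_isCoprime_charpoly {R k m : Type*} [CommRing R]
    [Fintype k] [DecidableEq k] [Fintype m] [DecidableEq m]
    {A : Matrix k k R} {B : Matrix m m R} {Y : Matrix m k R} (h : B * Y = Y * A)
    (hAB : IsCoprime A.charpoly B.charpoly) : Y = 0 := by
  obtain ⟨a, b, hab⟩ := hAB
  have hB := congrArg (aeval B) hab
  rw [map_add, map_mul, map_mul, aeval_self_charpoly B, mul_zero, add_zero, map_one] at hB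
  rw [← Matrix.one_mul Y, ← hB, Matrix.mul_assoc, aeval_mul_eq_mul_aeval_of_intertwines h,
    aeval_self_charpoly, Matrix.mul_zero, Matrix.mul_zero]

/-- The homogeneous Stein equation `X = B X Aᴴ` has only the trivial solution when `A` is similar
to `(Aᴴ)⁻¹` and the characteristic polynomials of `A` and `B` are coprime. -/
theorem Matrix.eq_zero_of_eq_mul_mul_conjTranspose {R k m : Type*} [CommRing R] [StarRing R]
    [Fintype k] [DecidableEq k] [Fintype m] [DecidableEq m]
    {A P : Matrix k k R} {B : Matrix m m R} {X : Matrix m k R} (hA : IsUnit A.det)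
    (hP : IsUnit P.det) (hsim : P⁻¹ * A * P = (Aᴴ)⁻¹)
    (hAB : IsCoprime A.charpoly B.charpoly) (hX : X = B * X * Aᴴ) : X = 0 := by
  have hAH : IsUnit (Aᴴ).det := by
    rw [det_conjTranspose]
    exact hA.star
  have hBX : B * X = X * (P⁻¹ * A * P) := by
    rw [hsim]
    conv_rhs => rw [hX]
    rw [mul_nonsing_inv_cancel_right _ _ hAH]
  have hY : X * P⁻¹ = 0 := by
    refine eq_zero_of_intertwines_of_isCoprime_charpoly ?_ hAB
    rw [← Matrix.mul_assoc, hBX, ← Matrix.mul_assoc, mul_nonsing_inv_cancel_right _ _ hP,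
      Matrix.mul_assoc]
  rw [← nonsing_inv_mul_cancel_right P X hP, hY, Matrix.zero_mul]

/-- If `T = diag(T₁, T₂)` with `T₁`, `T₂` invertible, disjoint spectra,
and `T₁` similar to `(T₁ᴴ)⁻¹`, then any `S` with `S = TSTᴴ` is block
diagonal: its off-diagonal blocks vanish. -/
theorem parameter_matrix_block_diagonal {k m : ℕ}
    (T₁ : Matrix (Fin k) (Fin k) ℂ) (T₂ : Matrix (Fin m) (Fin m) ℂ)
    (hT₁ : IsUnit T₁.det) (hT₂ : IsUnit T₂.det)
    (hdisj : ∀ μ : ℂ, ¬(T₁.charpoly.IsRoot μ ∧ T₂.charpoly.IsRoot μ))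
    (hsim : ∃ P : Matrix (Fin k) (Fin k) ℂ, IsUnit P.det ∧
      P⁻¹ * T₁ * P = (T₁ᴴ)⁻¹)
    (T : Matrix (Fin k ⊕ Fin m) (Fin k ⊕ Fin m) ℂ)
    (hT : T = Matrix.fromBlocks T₁ 0 0 T₂)
    (S : Matrix (Fin k ⊕ Fin m) (Fin k ⊕ Fin m) ℂ)
    (hS : S = T * S * Tᴴ) :
    S.toBlocks₁₂ = 0 ∧ S.toBlocks₂₁ = 0 := by
  obtain ⟨P, hP, hsim⟩ := hsim
  have hcop : IsCoprime T₁.charpoly T₂.charpoly := by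
    rw [Polynomial.isCoprime_iff_aeval_ne_zero_of_isAlgClosed ℂ ℂ]
    intro μ
    simpa [IsRoot, imp_iff_not_or] using hdisj μ
  rw [hT, ← fromBlocks_toBlocks S, fromBlocks_conjTranspose, fromBlocks_multiply,
    fromBlocks_multiply, fromBlocks_inj] at hS
  simp only [conjTranspose_zero, Matrix.zero_mul, Matrix.mul_zero, add_zero, zero_add] at hS
  obtain ⟨-, h₁₂, h₂₁, -⟩ := hS
  refine ⟨?_, eq_zero_of_eq_mul_mul_conjTranspose hT₁ hP hsim hcop h₂₁⟩
  rw [← conjTranspose_eq_zero]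
  refine eq_zero_of_eq_mul_mul_conjTranspose hT₁ hP hsim hcop ?_
  conv_lhs => rw [h₁₂]
  simp only [conjTranspose_mul, conjTranspose_conjTranspose, Matrix.mul_assoc]
end

section
/- Let A₁ ∈ ℂ^{n×n} be invertible and A₀ ∈ ℂ^{n×n} with A₀ᵀ = A₀, and let p(z) = det(z²A₁ᵀ + zA₀ + A₁) ∈ ℂ[z]. Then z = 1 is not a simple root of p and z = −1 is not a simple root of p; that is, the multiplicity of 1 as a root of p is not equal to 1, and the multiplicity of −1 as a root of p is not equal to 1. -/
open Matrix Polynomial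

/-- A polynomial that satisfies `p(z) = z ^ (2 * m) * p(1 / z)` for `z ≠ 0` has no simple root
at a point `s` with `s ^ 2 = 1`. -/
theorem Polynomial.rootMultiplicity_ne_one_of_palindromic (p : ℂ[X]) (m : ℕ)
    (hp : ∀ z : ℂ, z ≠ 0 → p.eval z = z ^ (2 * m) * p.eval z⁻¹) (s : ℂ) (hs : s ^ 2 = 1) :
    p.rootMultiplicity s ≠ 1 := by
  intro h
  have hp0 : p ≠ 0 := by
    rintro rfl
    simp at h
  have hroot : p.IsRoot s := (rootMultiplicity_pos hp0).1 (by omega)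
  have hs0 : s ≠ 0 := by
    rintro rfl
    simp at hs
  have hinv : s⁻¹ = s := inv_eq_of_mul_eq_one_left (by rw [← sq, hs])
  have hd : HasDerivAt (fun z : ℂ => p.eval z) (-p.derivative.eval s) s := by
    have hcomp := (p.hasDerivAt s⁻¹).comp s (hasDerivAt_inv hs0)
    have hmul := ((hasDerivAt_id s).pow (2 * m)).mul hcomp
    refine (hmul.congr_of_eventuallyEq ?_).congr_deriv ?_
    · filter_upwards [isOpen_ne.mem_nhds hs0] with z hz
      simpa using hp z hz
    · simp [hinv, hroot.eq_zero, hs, pow_mul]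
  have hderiv : p.derivative.eval s = 0 := self_eq_neg.1 ((p.hasDerivAt s).unique hd)
  have := (one_lt_rootMultiplicity_iff_isRoot hp0).2 ⟨hroot, hderiv⟩
  omega

/-- Evaluation of the determinant of a quadratic matrix polynomial. -/
theorem Matrix.eval_det_quadratic {n : ℕ} (A B C : Matrix (Fin n) (Fin n) ℂ) (z : ℂ) :
    (((X : ℂ[X]) ^ 2 • A.map Polynomial.C + (X : ℂ[X]) • B.map Polynomial.C +
      C.map Polynomial.C).det).eval z = (z ^ 2 • A + z • B + C).det := by
  rw [← coe_evalRingHom, RingHom.map_det]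
  congr 1
  ext i j
  simp
  ring

/-- For a regular ⊤-palindromic system `Q(λ) = λ²A₁ᵀ + λA₀ + A₁`
(`A₁` invertible, `A₀ᵀ = A₀`), neither `1` nor `-1` can be a simple
eigenvalue, i.e. a root of multiplicity exactly one of `det Q(z)`. -/
theorem one_not_simple_eigenvalue_top_palindromic {n : ℕ}
    (A₁ A₀ : Matrix (Fin n) (Fin n) ℂ)
    (hA₁ : IsUnit A₁.det) (hA₀ : A₀ᵀ = A₀)
    (p : Polynomial ℂ)
    (hp : p = (((Polynomial.X : Polynomial ℂ) ^ 2 • (A₁ᵀ.map Polynomial.C) +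
      (Polynomial.X : Polynomial ℂ) • (A₀.map Polynomial.C) + A₁.map Polynomial.C :
      Matrix (Fin n) (Fin n) (Polynomial ℂ))).det) :
    p.rootMultiplicity 1 ≠ 1 ∧ p.rootMultiplicity (-1) ≠ 1 := by
  have hpal : ∀ z : ℂ, z ≠ 0 → p.eval z = z ^ (2 * n) * p.eval z⁻¹ := by
    intro z hz
    rw [hp, Matrix.eval_det_quadratic, Matrix.eval_det_quadratic, ← det_transpose, pow_mul]
    have hdet := det_smul (z⁻¹ ^ 2 • A₁ᵀ + z⁻¹ • A₀ + A₁) (z ^ 2)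
    rw [Fintype.card_fin] at hdet
    rw [← hdet]
    congr 1
    simp only [transpose_add, transpose_smul, transpose_transpose, hA₀, smul_add, smul_smul]
    rw [show z ^ 2 * z⁻¹ ^ 2 = 1 by field_simp, show z ^ 2 * z⁻¹ = z by field_simp, one_smul]
    abel
  exact ⟨p.rootMultiplicity_ne_one_of_palindromic n hpal 1 (by norm_num),
    p.rootMultiplicity_ne_one_of_palindromic n hpal (-1) (by norm_num)⟩
end

section
/- Let ε = 1 or ε = −1, let A₁ ∈ ℂ^{n×n}, let A₀ ∈ ℂ^{n×n} with A₀ᴴ = εA₀, let X ∈ ℂ^{n×2n}, and let T ∈ ℂ^{2n×2n} be invertible. Set W = [X; −XT⁻¹], M = [[εA₁, 0],[−A₀, −Iₙ]], and L = [[0, Iₙ],[A₁ᴴ, 0]] (2n×2n block matrices). Then A₁ᴴXT² + A₀XT + εA₁X = 0 if and only if WᴴM = (Tᴴ)⁻¹WᴴL. -/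
open Matrix

/-- The eigen-equation `A₁ᴴXT² + A₀XT + εA₁X = 0` of a *-(anti)-palindromic
system is equivalent to the linearized relation `WᴴM = (Tᴴ)⁻¹WᴴL`, where
`W = [X; -XT⁻¹]`, `M = [[εA₁, 0],[-A₀, -I]]` and `L = [[0, I],[A₁ᴴ, 0]]`. -/
theorem eigen_equation_iff_linearization {n : ℕ} (ε : ℂ)
    (hε : ε = 1 ∨ ε = -1)
    (A₁ A₀ : Matrix (Fin n) (Fin n) ℂ) (hA₀ : A₀ᴴ = ε • A₀)
    (X : Matrix (Fin n) (Fin n ⊕ Fin n) ℂ)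
    (T : Matrix (Fin n ⊕ Fin n) (Fin n ⊕ Fin n) ℂ) (hT : IsUnit T.det)
    (W M L : Matrix (Fin n ⊕ Fin n) (Fin n ⊕ Fin n) ℂ)
    (hW : W = Matrix.fromRows X (-(X * T⁻¹)))
    (hM : M = Matrix.fromBlocks (ε • A₁) 0 (-A₀) (-1))
    (hL : L = Matrix.fromBlocks 0 1 A₁ᴴ 0) :
    A₁ᴴ * X * T ^ 2 + A₀ * X * T + ε • (A₁ * X) = 0 ↔
      Wᴴ * M = (Tᴴ)⁻¹ * Wᴴ * L := by
  have hε_star : star ε = ε := by rcases hε with rfl | rfl <;> simp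
  have hε_sq : ε * ε = 1 := by rcases hε with rfl | rfl <;> simp
  have hε_ne : ε ≠ 0 := left_ne_zero_of_mul_eq_one hε_sq
  have hTT : T⁻¹ * T = 1 := Matrix.nonsing_inv_mul T hT
  have hT_unit : IsUnit (T ^ 2) := ((Matrix.isUnit_iff_isUnit_det T).2 hT).pow 2
  have hWM : Mᴴ * W =
      Matrix.fromRows (ε • (A₁ᴴ * X) + ε • (A₀ * X * T⁻¹)) (X * T⁻¹) := by
    rw [hM, hW, Matrix.fromBlocks_conjTranspose, Matrix.fromBlocks_mul_fromRows]
    simp [hA₀, hε_star, Matrix.mul_assoc]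
  have hWL : Lᴴ * W * T⁻¹ =
      Matrix.fromRows (-(A₁ * X * T⁻¹ * T⁻¹)) (X * T⁻¹) := by
    rw [hL, hW, Matrix.fromBlocks_conjTranspose, Matrix.fromBlocks_mul_fromRows,
      Matrix.fromRows_mul]
    simp [Matrix.mul_assoc]
  have h_adjoint : Wᴴ * M = (Tᴴ)⁻¹ * Wᴴ * L ↔ Mᴴ * W = Lᴴ * W * T⁻¹ := by
    rw [← Matrix.conjTranspose_inj]
    simp [Matrix.conjTranspose_mul, Matrix.conjTranspose_nonsing_inv, Matrix.mul_assoc]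
  have h_factor : A₁ᴴ * X * T ^ 2 + A₀ * X * T + ε • (A₁ * X) =
      ε • ((ε • (A₁ᴴ * X) + ε • (A₀ * X * T⁻¹) + A₁ * X * T⁻¹ * T⁻¹) * T ^ 2) := by
    have h_cancel (Y : Matrix (Fin n) (Fin n ⊕ Fin n) ℂ) : Y * T⁻¹ * T = Y := by
      rw [Matrix.mul_assoc, hTT, Matrix.mul_one]
    simp only [pow_two, ← Matrix.mul_assoc, Matrix.add_mul, Matrix.smul_mul, smul_add,
      smul_smul, hε_sq, one_smul, h_cancel]
  have h_mul_eq_zero (Y : Matrix (Fin n) (Fin n ⊕ Fin n) ℂ) : Y * T ^ 2 = 0 ↔ Y = 0 := by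
    refine ⟨fun h => ?_, fun h => by rw [h, Matrix.zero_mul]⟩
    rw [← Matrix.mul_nonsing_inv_cancel_right (T ^ 2) Y
      ((Matrix.isUnit_iff_isUnit_det _).1 hT_unit), h, Matrix.zero_mul]
  rw [h_adjoint, hWM, hWL, h_factor, smul_eq_zero_iff_right hε_ne, h_mul_eq_zero,
    Matrix.fromRows_ext_iff, and_iff_left rfl, eq_neg_iff_add_eq_zero]
end
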